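/- arXiv:1703.02251 — 4 statements merged into one kernel-verified Lean document; each statement's English description precedes it below -/
import Mathlib

section
/- Let A be an r×n integer matrix with columns a_1,…,a_n ∈ ℤ^r. Then there exist a natural number D and a nonzero polynomial H ∈ ℂ[c_1,…,c_n,u_1,…,u_n] such that for every (c,u) ∈ (ℂ*)^n × ℂ^n with H(c,u) ≠ 0 the likelihood system for (A,c,u) has exactly D solutions. Moreover, for every scaling c ∈ (ℂ*)^n for which the Laurent polynomial f(θ) = Σ_{j=1}^n c_j θ^{a_j} has a singular point in the torus — i.e., there exists θ ∈ (ℂ*)^r with f(θ) = 0 and (∂f/∂θ_i)(θ) = 0 for all i = 1,…,r — there exist a natural number N with N < D and a nonzero polynomial G ∈ ℂ[u_1,…,u_n] such that for every u ∈ ℂ^n with G(u) ≠ 0 the likelihood system for (A,c,u) has exactly N solutions. (Such c lie in the zero locus Σ_A of the principal A-determinant, and the conclusion says the ML degree of V^c is strictly smaller than deg V.) -/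
open scoped BigOperators

/-- The likelihood system for a matrix `A` (rows indexed by `κ`, columns by `ι`),
scaling vector `c` and data vector `u`: the set of points `p` of the torus lying on
the toric variety of `A` (binomial equations from the kernel lattice of the
row-augmented matrix), normalized by `∑ c j * p j = 1`, and matching the
sufficient statistics `A u`. -/
def mlSolutions {κ ι : Type*} [Fintype κ] [Fintype ι] (A : κ → ι → ℤ)
    (c u : ι → ℂ) : Set (ι → ℂ) :=
  {p | (∀ j, p j ≠ 0) ∧
    (∀ v : ι → ℤ, (∀ i, ∑ j, A i j * v j = 0) → (∑ j, v j = 0) →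
      (∏ j, p j ^ (max (v j) 0).toNat) = (∏ j, p j ^ (max (-v j) 0).toNat)) ∧
    (∑ j, c j * p j = 1) ∧
    (∀ i, (∑ j, u j) * (∑ j, (A i j : ℂ) * (c j * p j)) = ∑ j, (A i j : ℂ) * u j)}

open Polynomial in
/-- A finitely generated algebraic extension of domains of characteristic zero is, after inverting
one element of the base, generated by a single integral element. -/
theorem exists_integral_primitive_element {R S : Type*} [CommRing R] [CommRing S] [IsDomain R]
    [IsDomain S] [CharZero R] [Algebra R S] [FaithfulSMul R S] [Algebra.IsAlgebraic R S]
    [Algebra.FiniteType R S] :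
    ∃ (α : S) (r : R), IsIntegral R α ∧ r ≠ 0 ∧
      ∀ s : S, ∃ (k : ℕ) (P : R[X]), algebraMap R S r ^ k * s = aeval α P := by
  classical
  let K := FractionRing R
  let L := FractionRing S
  have : FaithfulSMul R L := FaithfulSMul.trans R S L
  let _ : Algebra K L := FractionRing.liftAlgebra R L
  have : IsScalarTower R K L := FractionRing.isScalarTower_liftAlgebra R L
  have : Algebra.IsAlgebraic K L := by
    have h1 : Algebra.IsAlgebraic R L := (IsFractionRing.isAlgebraic_iff' R S L).1 inferInstance
    exact (IsFractionRing.comap_isAlgebraic_iff (A := R) (K := K) (C := L)).1 h1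
  have : Algebra.EssFiniteType S L := Algebra.EssFiniteType.of_isLocalization L (nonZeroDivisors S)
  have : Algebra.EssFiniteType R L := Algebra.EssFiniteType.comp R S L
  have : Algebra.EssFiniteType K L := Algebra.EssFiniteType.of_comp R K L
  have : FiniteDimensional K L := by
    obtain ⟨t, ht⟩ := IntermediateField.fg_top K L
    have h2 := IntermediateField.finiteDimensional_adjoin (K := K) (L := L) (S := (t : Set L))
      (fun x _ => Algebra.IsIntegral.isIntegral x)
    rw [ht] at h2
    exact IntermediateField.topEquiv.toLinearEquiv.finiteDimensional
  have : CharZero K := IsFractionRing.charZero R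
  obtain ⟨x, hx⟩ := Field.exists_primitive_element K L
  have hx' : ∀ z : L, ∃ Q : K[X], aeval x Q = z := by
    intro z
    have h3 := IntermediateField.adjoin_simple_toSubalgebra_of_isAlgebraic
      (Algebra.IsAlgebraic.isAlgebraic (R := K) x)
    rw [hx, IntermediateField.top_toSubalgebra] at h3
    have hz : z ∈ Algebra.adjoin K {x} := by rw [← h3]; trivial
    rw [Algebra.adjoin_singleton_eq_range_aeval] at hz
    exact hz
  obtain ⟨a, b, hb, rfl⟩ := IsFractionRing.div_surjective (A := S) x
  obtain ⟨r₀, hr₀, b', hb'⟩ := (Algebra.IsAlgebraic.isAlgebraic (R := R) b).exists_nonzero_dvd hb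
  obtain ⟨y, hy, hyint⟩ :=
    (Algebra.IsAlgebraic.isAlgebraic (R := R) (a * b')).exists_integral_multiple
  have hb0 : algebraMap S L b ≠ 0 := by
    simpa using nonZeroDivisors.ne_zero hb
  set d : K := algebraMap R K (y * r₀) with hd
  have hd0 : d ≠ 0 := by simp [hd, hy, hr₀]
  have hα : algebraMap S L (y • (a * b')) =
      algebraMap K L d * (algebraMap S L a / algebraMap S L b) := by
    rw [hd, ← IsScalarTower.algebraMap_apply R K L, map_mul,
      IsScalarTower.algebraMap_apply R S L r₀,
      hb', Algebra.smul_def, IsScalarTower.algebraMap_apply R S L y]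
    simp only [map_mul]
    rw [mul_assoc, mul_assoc, mul_div_assoc', mul_div_assoc', mul_div_cancel_left₀ _ hb0]
    ring
  generalize y • (a * b') = α at hyint hα
  have key : ∀ s : S, ∃ (r : R) (P : R[X]), r ≠ 0 ∧ algebraMap R S r * s = aeval α P := by
    intro s
    obtain ⟨Q, hQ⟩ := hx' (algebraMap S L s)
    set Q' : K[X] := Q.comp (C d⁻¹ * X) with hQ'
    have hs : aeval (algebraMap S L α) Q' = algebraMap S L s := by
      rw [hQ', aeval_comp, ← hQ, hα]
      congr 1
      simp [hd0]
    obtain ⟨e, he, hP⟩ := IsLocalization.integerNormalization_spec (nonZeroDivisors R) Q'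
    refine ⟨e, IsLocalization.integerNormalization (nonZeroDivisors R) Q',
      nonZeroDivisors.ne_zero he, IsFractionRing.injective S L ?_⟩
    rw [← aeval_algebraMap_apply, ← aeval_map_algebraMap K, hP, map_mul, ← hs,
      ← IsScalarTower.algebraMap_smul K e Q', map_smul (aeval (algebraMap S L α)), Algebra.smul_def,
      ← IsScalarTower.algebraMap_apply R K L, ← IsScalarTower.algebraMap_apply R S L]
  choose ρ P hρ hP using key
  obtain ⟨T, hT⟩ := (Algebra.FiniteType.out : (⊤ : Subalgebra R S).FG)
  refine ⟨α, ∏ s ∈ T, ρ s, hyint, Finset.prod_ne_zero_iff.2 fun s _ => hρ s, fun s => ?_⟩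
  have hs : s ∈ Algebra.adjoin R (T : Set S) := by rw [hT]; trivial
  induction hs using Algebra.adjoin_induction with
  | mem s hs =>
    refine ⟨1, C (∏ s ∈ T.erase s, ρ s) * P s, ?_⟩
    rw [map_mul, ← hP, ← Finset.mul_prod_erase T ρ hs]
    simp
    ring
  | algebraMap r => exact ⟨0, C r, by simp⟩
  | add x y _ _ hx hy =>
    obtain ⟨k, P, hk⟩ := hx
    obtain ⟨l, Q, hl⟩ := hy
    refine ⟨k + l, C ((∏ s ∈ T, ρ s) ^ l) * P + C ((∏ s ∈ T, ρ s) ^ k) * Q, ?_⟩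
    rw [map_add, map_mul, map_mul, ← hk, ← hl]
    simp only [aeval_C, map_pow]
    ring
  | mul x y _ _ hx hy =>
    obtain ⟨k, P, hk⟩ := hx
    obtain ⟨l, Q, hl⟩ := hy
    refine ⟨k + l, P * Q, ?_⟩
    rw [map_mul, ← hk, ← hl]
    ring

/-- A ring homomorphism out of `A` extends along `ι : A → S` when it kills `ker ι` and every element
of `S` is a fraction whose denominator is a power of one element not mapping to zero. -/
theorem exists_ringHom_extension {A S F : Type*} [CommRing A] [CommRing S] [Field F]
    (ι : A →+* S) (χ : A →+* F) (r : A) (hr : χ r ≠ 0) (hker : ∀ a, ι a = 0 → χ a = 0)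
    (hfrac : ∀ s, ∃ (k : ℕ) (a : A), ι r ^ k * s = ι a) :
    ∃ ψ : S →+* F, ∀ a, ψ (ι a) = χ a := by
  have hker' : ∀ a b, ι a = ι b → χ a = χ b := fun a b h => by
    have := hker (a - b) (by rw [map_sub, h, sub_self])
    rwa [map_sub, sub_eq_zero] at this
  choose k a ha using hfrac
  have spec : ∀ (s : S) (l : ℕ) (b : A), ι r ^ l * s = ι b → χ (a s) / χ r ^ k s = χ b / χ r ^ l := by
    intro s l b h
    rw [div_eq_div_iff (pow_ne_zero _ hr) (pow_ne_zero _ hr), ← map_pow, ← map_pow, ← map_mul,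
      ← map_mul]
    apply hker'
    rw [map_mul, map_mul, ← ha, ← h, map_pow, map_pow]
    ring
  refine ⟨{ toFun := fun s => χ (a s) / χ r ^ k s, map_one' := ?_, map_mul' := ?_, map_zero' := ?_,
            map_add' := ?_ }, fun b => ?_⟩
  · rw [spec 1 0 1 (by simp)]; simp
  · intro s t
    rw [spec (s * t) (k s + k t) (a s * a t) (by rw [map_mul, ← ha, ← ha]; ring), map_mul]
    field_simp
    ring
  · rw [spec 0 0 0 (by simp)]; simp
  · intro s t
    rw [spec (s + t) (k s + k t) (r ^ k t * a s + r ^ k s * a t)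
      (by simp only [map_add, map_mul, map_pow, ← ha]; ring)]
    simp only [map_add, map_mul, map_pow]
    field_simp
    ring
  · change χ (a (ι b)) / χ r ^ k (ι b) = _
    rw [spec (ι b) 0 b (by simp)]; simp

open Polynomial in
/-- The Bézout relation witnessing separability of a minimal polynomial, with denominators
cleared. -/
theorem exists_bezout_minpoly_derivative {R S : Type*} [CommRing R] [CommRing S] [IsDomain R]
    [IsDomain S] [CharZero R] [IsIntegrallyClosed R] [Algebra R S] [FaithfulSMul R S]
    {α : S} (hα : IsIntegral R α) :
    ∃ (e : R) (a b : R[X]), e ≠ 0 ∧ a * minpoly R α + b * derivative (minpoly R α) = C e := by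
  let K := FractionRing R
  let L := FractionRing S
  have : FaithfulSMul R L := FaithfulSMul.trans R S L
  let _ : Algebra K L := FractionRing.liftAlgebra R L
  have : IsScalarTower R K L := FractionRing.isScalarTower_liftAlgebra R L
  have : CharZero K := IsFractionRing.charZero R
  have hmap := minpoly.isIntegrallyClosed_eq_field_fractions K L hα
  have hirr : Irreducible (minpoly K (algebraMap S L α)) :=
    minpoly.irreducible (hα.algebraMap.tower_top)
  obtain ⟨a, b, hab⟩ := hirr.separable
  obtain ⟨e, he, ha⟩ := IsLocalization.integerNormalization_spec (nonZeroDivisors R) a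
  obtain ⟨e', he', hb⟩ := IsLocalization.integerNormalization_spec (nonZeroDivisors R) b
  refine ⟨e * e', C e' * IsLocalization.integerNormalization (nonZeroDivisors R) a,
    C e * IsLocalization.integerNormalization (nonZeroDivisors R) b,
    mul_ne_zero (nonZeroDivisors.ne_zero he) (nonZeroDivisors.ne_zero he'), ?_⟩
  apply Polynomial.map_injective (algebraMap R K) (IsFractionRing.injective R K)
  simp only [Polynomial.map_add, Polynomial.map_mul, map_C, ha, hb, ← derivative_map, ← hmap]
  rw [← IsScalarTower.algebraMap_smul K e a, ← IsScalarTower.algebraMap_smul K e' b,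
    Polynomial.smul_eq_C_mul, Polynomial.smul_eq_C_mul, map_mul, C_mul]
  linear_combination (C (algebraMap R K e) * C (algebraMap R K e')) * hab

open Polynomial in
/-- Every algebraic element is a root of a polynomial over the base which is separable away from a
nonzero element of the base. -/
theorem exists_bezout_derivative {R S : Type*} [CommRing R] [CommRing S] [IsDomain R]
    [IsDomain S] [CharZero R] [IsIntegrallyClosed R] [Algebra R S] [FaithfulSMul R S]
    {s : S} (hs : IsAlgebraic R s) :
    ∃ (M : R[X]) (e : R) (a b : R[X]), e ≠ 0 ∧ aeval s M = 0 ∧ a * M + b * derivative M = C e := by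
  obtain ⟨y, hy, hyint⟩ := hs.exists_integral_multiple
  obtain ⟨e, a, b, he, hab⟩ := exists_bezout_minpoly_derivative hyint
  refine ⟨(minpoly R (y • s)).comp (C y * X), y * e, C y * a.comp (C y * X), b.comp (C y * X),
    mul_ne_zero hy he, ?_, ?_⟩
  · rw [aeval_comp]
    simp [← Algebra.smul_def]
  · have := congrArg (fun p => C y * p.comp (C y * X)) hab
    simp only [add_comp, mul_comp, C_comp] at this
    rw [C_mul, ← this, derivative_comp]
    simp
    ring

open Polynomial in
/-- In a generically finite extension of domains, almost all specializations of the base to an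
algebraically closed field have the same positive number of extensions. -/
theorem exists_ncard_extensions {R S : Type*} [CommRing R] [CommRing S] [IsDomain R]
    [IsDomain S] [CharZero R] [IsIntegrallyClosed R] [Algebra R S] [FaithfulSMul R S]
    [Algebra.IsAlgebraic R S] [Algebra.FiniteType R S] (F : Type*) [Field F] [IsAlgClosed F] :
    ∃ (N : ℕ) (f : R), 0 < N ∧ f ≠ 0 ∧ ∀ φ : R →+* F, φ f ≠ 0 →
      {ψ : S →+* F | ψ.comp (algebraMap R S) = φ}.Finite ∧
      {ψ : S →+* F | ψ.comp (algebraMap R S) = φ}.ncard = N := by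
  classical
  obtain ⟨α, r, hα, hr, hfrac⟩ := exists_integral_primitive_element (R := R) (S := S)
  obtain ⟨e, a, b, he, hab⟩ := exists_bezout_minpoly_derivative hα
  refine ⟨(minpoly R α).natDegree, e * r, minpoly.natDegree_pos hα, mul_ne_zero he hr,
    fun φ hφ => ?_⟩
  rw [map_mul] at hφ
  have hφe := left_ne_zero_of_mul hφ
  have hφr := right_ne_zero_of_mul hφ
  set g : F[X] := (minpoly R α).map φ with hg
  have hgm : g.Monic := (minpoly.monic hα).map φ
  have hsep : g.Separable := by
    refine ⟨C (φ e)⁻¹ * a.map φ, C (φ e)⁻¹ * b.map φ, ?_⟩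
    have h1 := congrArg (Polynomial.map φ) hab
    simp only [Polynomial.map_add, Polynomial.map_mul, map_C, ← derivative_map] at h1
    rw [mul_assoc, mul_assoc, ← mul_add, h1, ← C_mul, inv_mul_cancel₀ hφe, C_1]
  have hcard : g.roots.toFinset.card = (minpoly R α).natDegree := by
    rw [Multiset.toFinset_card_of_nodup (nodup_roots hsep),
      ← (minpoly.monic hα).natDegree_map φ]
    exact (IsAlgClosed.splits g).natDegree_eq_card_roots.symm
  have hmem : ∀ ρ, ρ ∈ (g.roots.toFinset : Set F) ↔ eval₂ φ ρ (minpoly R α) = 0 := fun ρ => by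
    rw [Finset.mem_coe, Multiset.mem_toFinset, mem_roots hgm.ne_zero, IsRoot, hg, eval_map]
  have heval : ∀ ψ : S →+* F, ψ.comp (algebraMap R S) = φ → ∀ P : R[X],
      ψ (aeval α P) = eval₂ φ (ψ α) P := by
    rintro ψ rfl P
    rw [aeval_def, hom_eval₂]
  have hbij : Set.BijOn (fun ψ : S →+* F => ψ α) {ψ : S →+* F | ψ.comp (algebraMap R S) = φ}
      (g.roots.toFinset : Set F) := by
    refine ⟨fun ψ hψ => ?_, fun ψ hψ ψ' hψ' h => ?_, fun ρ hρ => ?_⟩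
    · rw [hmem, ← heval ψ hψ, minpoly.aeval, map_zero]
    · ext s
      obtain ⟨k, P, hP⟩ := hfrac s
      have h1 := congrArg ψ hP
      have h2 := congrArg ψ' hP
      rw [heval ψ hψ] at h1
      rw [heval ψ' hψ', ← show ψ α = ψ' α from h, ← h1] at h2
      have e1 : ψ (algebraMap R S r) = φ r := by rw [← hψ]; rfl
      have e2 : ψ' (algebraMap R S r) = φ r := by rw [← hψ']; rfl
      rw [map_mul, map_mul, map_pow, map_pow, e1, e2] at h2
      exact (mul_left_cancel₀ (pow_ne_zero _ hφr) h2).symm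
    · rw [hmem] at hρ
      obtain ⟨ψ, hψ⟩ := exists_ringHom_extension (aeval (R := R) α).toRingHom (eval₂RingHom φ ρ)
        (C r) (by simpa using hφr)
        (fun h hh => by
          obtain ⟨q, rfl⟩ := minpoly.isIntegrallyClosed_dvd hα (p := h) hh
          simp [eval₂_mul, hρ])
        (fun s => by simpa using hfrac s)
      refine ⟨ψ, ?_, ?_⟩
      · ext x
        simpa using hψ (C x)
      · simpa using hψ X
  constructor
  · exact hbij.finite_iff_finite.2 (Finset.finite_toSet _)
  · rw [← hcard, ← Set.ncard_coe_finset, ← hbij.image_eq, hbij.injOn.ncard_image]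

section TranscendenceBasis

variable {τ S : Type*} [CommRing S] [IsDomain S] [Algebra ℂ S] {y : τ → S}

omit [IsDomain S] in
/-- Adjoining a transcendence basis leaves an algebraic extension. -/
theorem IsTranscendenceBasis.isAlgebraic_aeval (hy : IsTranscendenceBasis ℂ y) (s : S) :
    ∃ p : Polynomial (MvPolynomial τ ℂ), p ≠ 0 ∧
      p.eval₂ (MvPolynomial.aeval (R := ℂ) y).toRingHom s = 0 := by
  have h := hy.isAlgebraic
  obtain ⟨p, hp0, hp⟩ := h.isAlgebraic s
  let e := hy.1.aevalEquiv
  refine ⟨p.map e.symm.toRingHom, ?_, ?_⟩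
  · exact (Polynomial.map_ne_zero_iff e.symm.injective).2 hp0
  · have hcomp : (MvPolynomial.aeval (R := ℂ) y).toRingHom.comp e.symm.toRingHom =
        algebraMap (Algebra.adjoin ℂ (Set.range y)) S := RingHom.ext fun a => by
      change MvPolynomial.aeval y (e.symm a) = (a : S)
      rw [← hy.1.algebraMap_aevalEquiv (e.symm a), AlgEquiv.apply_symm_apply]
      rfl
    rw [Polynomial.eval₂_map]
    exact (congrArg (fun j => Polynomial.eval₂ j s p) hcomp).trans hp

/-- Almost all values of a transcendence basis are taken by the same positive number of complex
points. -/
theorem IsTranscendenceBasis.exists_ncard_algHom [Algebra.FiniteType ℂ S]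
    (hy : IsTranscendenceBasis ℂ y) :
    ∃ (N : ℕ) (f : MvPolynomial τ ℂ), 0 < N ∧ f ≠ 0 ∧ ∀ w : τ → ℂ, MvPolynomial.eval w f ≠ 0 →
      {ψ : S →ₐ[ℂ] ℂ | ∀ i, ψ (y i) = w i}.Finite ∧
      {ψ : S →ₐ[ℂ] ℂ | ∀ i, ψ (y i) = w i}.ncard = N := by
  have halg := hy.isAlgebraic_aeval
  let _ : Algebra (MvPolynomial τ ℂ) S := (MvPolynomial.aeval (R := ℂ) y).toAlgebra
  have : IsScalarTower ℂ (MvPolynomial τ ℂ) S :=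
    .of_algebraMap_eq fun z => ((MvPolynomial.aeval (R := ℂ) y).commutes z).symm
  have : Algebra.IsAlgebraic (MvPolynomial τ ℂ) S := ⟨halg⟩
  have : FaithfulSMul (MvPolynomial τ ℂ) S := (faithfulSMul_iff_algebraMap_injective _ _).2 hy.1
  have : Algebra.FiniteType (MvPolynomial τ ℂ) S :=
    Algebra.FiniteType.of_restrictScalars_finiteType ℂ _ _
  obtain ⟨N, f, hN, hf, h⟩ := exists_ncard_extensions (R := MvPolynomial τ ℂ) (S := S) ℂ
  refine ⟨N, f, hN, hf, fun w hw => ?_⟩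
  obtain ⟨hfin, hcard⟩ := h (MvPolynomial.eval w) hw
  have himg : (fun ψ : S →ₐ[ℂ] ℂ => (ψ : S →+* ℂ)) '' {ψ : S →ₐ[ℂ] ℂ | ∀ i, ψ (y i) = w i} =
      {ψ : S →+* ℂ | ψ.comp (algebraMap (MvPolynomial τ ℂ) S) = MvPolynomial.eval w} := by
    ext ψ
    constructor
    · rintro ⟨ψ, hψ, rfl⟩
      refine MvPolynomial.ringHom_ext (fun z => ?_) fun i => ?_
      · change ψ (MvPolynomial.aeval y (MvPolynomial.C z)) = _
        simp
      · change ψ (MvPolynomial.aeval y (MvPolynomial.X i)) = _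
        simpa using hψ i
    · intro hψ
      refine ⟨{ toRingHom := ψ, commutes' := fun z => ?_ }, fun i => ?_, ?_⟩
      · have h1 := RingHom.congr_fun hψ (MvPolynomial.C z)
        change ψ (MvPolynomial.aeval y (MvPolynomial.C z)) = _ at h1
        simpa using h1
      · have h1 := RingHom.congr_fun hψ (MvPolynomial.X i)
        change ψ (MvPolynomial.aeval y (MvPolynomial.X i)) = _ at h1
        simpa using h1
      · rfl
  have hinj : Function.Injective (fun ψ : S →ₐ[ℂ] ℂ => (ψ : S →+* ℂ)) :=
    AlgHom.coe_ringHom_injective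
  rw [← himg] at hfin hcard
  exact ⟨(Set.finite_image_iff hinj.injOn).1 hfin,
    by rw [← hcard, Set.ncard_image_of_injective _ hinj]⟩

/-- Every element satisfies an equation over a transcendence basis whose specializations at almost
all complex points have a simple root there. -/
theorem IsTranscendenceBasis.exists_separable_equation (hy : IsTranscendenceBasis ℂ y) (s : S) :
    ∃ (M : Polynomial (MvPolynomial τ ℂ)) (e : MvPolynomial τ ℂ), e ≠ 0 ∧
      ∀ (w : τ → ℂ) (ψ : S →ₐ[ℂ] ℂ), (∀ i, ψ (y i) = w i) →
        (M.map (MvPolynomial.eval w)).eval (ψ s) = 0 ∧ (MvPolynomial.eval w e ≠ 0 →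
          (M.derivative.map (MvPolynomial.eval w)).eval (ψ s) ≠ 0) := by
  have halg := hy.isAlgebraic_aeval
  let _ : Algebra (MvPolynomial τ ℂ) S := (MvPolynomial.aeval (R := ℂ) y).toAlgebra
  have : FaithfulSMul (MvPolynomial τ ℂ) S := (faithfulSMul_iff_algebraMap_injective _ _).2 hy.1
  obtain ⟨M, e, a, b, he, hM, hab⟩ :=
    exists_bezout_derivative (R := MvPolynomial τ ℂ) (S := S) (halg s)
  refine ⟨M, e, he, fun w ψ hψ => ?_⟩
  have hcomp : (ψ : S →+* ℂ).comp (algebraMap (MvPolynomial τ ℂ) S) = MvPolynomial.eval w := by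
    refine MvPolynomial.ringHom_ext (fun z => ?_) fun i => ?_
    · change ψ (MvPolynomial.aeval y (MvPolynomial.C z)) = _
      simp
    · change ψ (MvPolynomial.aeval y (MvPolynomial.X i)) = _
      simpa using hψ i
  have hroot : (M.map (MvPolynomial.eval w)).eval (ψ s) = 0 := by
    rw [Polynomial.eval_map, ← hcomp]
    have := congrArg ψ hM
    rw [map_zero, Polynomial.aeval_def] at this
    rw [← this]
    exact (Polynomial.hom_eval₂ _ _ (ψ : S →+* ℂ) _).symm
  refine ⟨hroot, fun hew h0 => hew ?_⟩
  have h1 := congrArg (fun p => (p.map (MvPolynomial.eval w)).eval (ψ s)) hab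
  simpa [hroot, h0] using h1.symm

end TranscendenceBasis

section PrincipalOpen

open MvPolynomial

variable {τ : Type} {π : MvPolynomial τ ℂ}

/-- A point of a principal open subset of affine space as a point of its coordinate ring. -/
noncomputable def evalAway (x : τ → ℂ) (hx : eval x π ≠ 0) : Localization.Away π →ₐ[ℂ] ℂ :=
  IsLocalization.liftAlgHom (M := Submonoid.powers π) (f := aeval x) (by
    rintro ⟨_, k, rfl⟩
    simpa [aeval_eq_eval] using fun h : eval x π = 0 => absurd h hx)

theorem evalAway_algebraMap (x : τ → ℂ) (hx : eval x π ≠ 0) (p : MvPolynomial τ ℂ) :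
    evalAway x hx (algebraMap (MvPolynomial τ ℂ) (Localization.Away π) p) = eval x p := by
  simp [evalAway]

theorem algHom_away_apply (ψ : Localization.Away π →ₐ[ℂ] ℂ) (p : MvPolynomial τ ℂ) :
    ψ (algebraMap (MvPolynomial τ ℂ) (Localization.Away π) p) =
      eval (fun k => ψ (algebraMap (MvPolynomial τ ℂ) (Localization.Away π) (X k))) p := by
  have : (ψ.comp (Algebra.algHom ℂ (MvPolynomial τ ℂ) (Localization.Away π))) =
      aeval (fun k => ψ (algebraMap (MvPolynomial τ ℂ) (Localization.Away π) (X k))) := by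
    ext k
    rw [aeval_X]
    rfl
  have := DFunLike.congr_fun this p
  rw [aeval_eq_eval] at this
  exact this

theorem eval_ne_zero_of_algHom_away (ψ : Localization.Away π →ₐ[ℂ] ℂ) :
    eval (fun k => ψ (algebraMap (MvPolynomial τ ℂ) (Localization.Away π) (X k))) π ≠ 0 := by
  rw [← algHom_away_apply]
  exact ((IsLocalization.Away.algebraMap_isUnit π).map ψ).ne_zero

theorem algHom_away_ext {ψ ψ' : Localization.Away π →ₐ[ℂ] ℂ}
    (h : ∀ k, ψ (algebraMap (MvPolynomial τ ℂ) (Localization.Away π) (X k)) =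
      ψ' (algebraMap (MvPolynomial τ ℂ) (Localization.Away π) (X k))) : ψ = ψ' := by
  apply AlgHom.coe_ringHom_injective
  apply IsLocalization.ringHom_ext (Submonoid.powers π)
  refine MvPolynomial.ringHom_ext (fun z => ?_) h
  have hz : algebraMap (MvPolynomial τ ℂ) (Localization.Away π) (C z) =
      algebraMap ℂ (Localization.Away π) z :=
    (IsScalarTower.algebraMap_apply ℂ (MvPolynomial τ ℂ) (Localization.Away π) z).symm
  change ψ (algebraMap (MvPolynomial τ ℂ) (Localization.Away π) (C z)) =
    ψ' (algebraMap (MvPolynomial τ ℂ) (Localization.Away π) (C z))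
  rw [hz, AlgHom.commutes, AlgHom.commutes]

variable [Finite τ] (hπ : π ≠ 0) {y : τ → Localization.Away π} {Y : (τ → ℂ) → τ → ℂ}
  (hY : ∀ (ψ : Localization.Away π →ₐ[ℂ] ℂ) i,
    ψ (y i) = Y (fun k => ψ (algebraMap (MvPolynomial τ ℂ) (Localization.Away π) (X k))) i)
  (hdom : ∀ f : MvPolynomial τ ℂ, (∀ x, eval x π ≠ 0 → eval (Y x) f = 0) → f = 0)

omit [Finite τ] in
include hπ in
theorem isDomain_away : IsDomain (Localization.Away π) :=
  IsLocalization.isDomain_localization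
    (Submonoid.powers_le.2 (mem_nonZeroDivisors_of_ne_zero hπ))

include hπ hY hdom in
/-- The coordinates of a dominant endomorphism form a transcendence basis. -/
theorem isTranscendenceBasis_of_dominant : IsTranscendenceBasis ℂ y := by
  have := isDomain_away hπ
  have hind : AlgebraicIndependent ℂ y := by
    refine (injective_iff_map_eq_zero _).2 fun f hf => hdom f fun x hx => ?_
    have h1 := congrArg (evalAway x hx) hf
    rw [map_zero] at h1
    rw [← h1]
    have h2 : (evalAway x hx).comp (aeval y) = aeval (Y x) := by
      ext i
      simp only [AlgHom.comp_apply, aeval_X]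
      rw [hY]
      congr 1
      funext k
      rw [evalAway_algebraMap, eval_X]
    have h3 := DFunLike.congr_fun h2 f
    rw [aeval_eq_eval] at h3
    exact h3.symm
  refine hind.isTranscendenceBasis_of_trdeg_le_of_finite ?_
  have hle := Submonoid.powers_le.2 (mem_nonZeroDivisors_of_ne_zero hπ)
  have : FaithfulSMul (MvPolynomial τ ℂ) (Localization.Away π) :=
    (faithfulSMul_iff_algebraMap_injective _ _).2 (IsLocalization.injective _ hle)
  have : Algebra.IsAlgebraic (MvPolynomial τ ℂ) (Localization.Away π) :=
    IsLocalization.isAlgebraic _ (Submonoid.powers π)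
  have h0 : Algebra.trdeg (MvPolynomial τ ℂ) (Localization.Away π) = 0 :=
    trdeg_eq_zero
  have h1 := trdeg_add_eq ℂ (MvPolynomial τ ℂ) (A := Localization.Away π)
  rw [h0, add_zero, MvPolynomial.trdeg_of_isDomain, Cardinal.lift_id] at h1
  exact h1.ge

include hπ hY hdom in
/-- Almost all fibres of a dominant endomorphism of a principal open subset of affine space have the
same positive number of points. -/
theorem exists_ncard_fiber_of_dominant :
    ∃ (N : ℕ) (f : MvPolynomial τ ℂ), 0 < N ∧ f ≠ 0 ∧ ∀ w : τ → ℂ, eval w f ≠ 0 →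
      {x | eval x π ≠ 0 ∧ Y x = w}.Finite ∧ {x | eval x π ≠ 0 ∧ Y x = w}.ncard = N := by
  have := isDomain_away hπ
  have : Algebra.FiniteType ℂ (Localization.Away π) :=
    (inferInstance : Algebra.FiniteType ℂ (MvPolynomial τ ℂ)).trans
      (IsLocalization.finiteType_of_monoid_fg (Submonoid.powers π) _)
  obtain ⟨N, f, hN, hf, h⟩ :=
    (isTranscendenceBasis_of_dominant hπ hY hdom).exists_ncard_algHom
  refine ⟨N, f, hN, hf, fun w hw => ?_⟩
  obtain ⟨hfin, hcard⟩ := h w hw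
  have hbij : Set.BijOn (fun (ψ : Localization.Away π →ₐ[ℂ] ℂ) k =>
      ψ (algebraMap (MvPolynomial τ ℂ) (Localization.Away π) (X k)))
      {ψ | ∀ i, ψ (y i) = w i} {x | eval x π ≠ 0 ∧ Y x = w} := by
    refine ⟨fun ψ hψ => ⟨eval_ne_zero_of_algHom_away ψ, ?_⟩, fun ψ _ ψ' _ h => ?_, ?_⟩
    · funext i
      rw [← hY, hψ i]
    · exact algHom_away_ext fun k => congrFun h k
    · rintro x ⟨hx, hw⟩
      refine ⟨evalAway x hx, fun i => ?_, ?_⟩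
      · rw [hY, ← hw]
        congr 1
        funext k
        rw [evalAway_algebraMap, eval_X]
      · funext k
        simp only [evalAway_algebraMap, eval_X]
  rw [← hbij.image_eq]
  exact ⟨hfin.image _, by rw [hbij.injOn.ncard_image, hcard]⟩

include hπ hY hdom in
/-- Each coordinate is, on almost all fibres of a dominant endomorphism, a simple root of a
polynomial whose coefficients are polynomials in the value of the endomorphism. -/
theorem exists_separable_equation_of_dominant (k : τ) :
    ∃ (M : Polynomial (MvPolynomial τ ℂ)) (e : MvPolynomial τ ℂ), e ≠ 0 ∧
      ∀ x : τ → ℂ, eval x π ≠ 0 →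
        (M.map (eval (Y x))).eval (x k) = 0 ∧ (eval (Y x) e ≠ 0 →
          (M.derivative.map (eval (Y x))).eval (x k) ≠ 0) := by
  have := isDomain_away hπ
  obtain ⟨M, e, he, h⟩ :=
    (isTranscendenceBasis_of_dominant hπ hY hdom).exists_separable_equation
      (algebraMap (MvPolynomial τ ℂ) (Localization.Away π) (X k))
  refine ⟨M, e, he, fun x hx => ?_⟩
  have := h (Y x) (evalAway x hx) fun i => by
    rw [hY]
    congr 1
    funext k
    rw [evalAway_algebraMap, eval_X]
  simpa only [evalAway_algebraMap, eval_X] using this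

end PrincipalOpen

section Lattice

open Matrix

/-- The Gram matrix of an injective integer matrix is nonsingular. -/
theorem Matrix.det_transpose_mul_self_ne_zero_of_injective {κ μ : Type*} [Fintype κ] [Fintype μ]
    [DecidableEq μ] (N : Matrix κ μ ℤ) (h : ∀ y, N *ᵥ y = 0 → y = 0) : (Nᵀ * N).det ≠ 0 := by
  intro h0
  obtain ⟨y, hy, hy0⟩ := Matrix.exists_mulVec_eq_zero_iff.2 h0
  refine hy (h y (dotProduct_self_eq_zero.1 ?_))
  have h1 := congrArg (y ⬝ᵥ ·) hy0
  simpa only [← mulVec_mulVec, dotProduct_mulVec, vecMul_transpose, dotProduct_zero] using h1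

/-- An injective integer matrix stays injective over the complex numbers. -/
theorem Matrix.eq_zero_of_map_intCast_mulVec_eq_zero {κ μ : Type*} [Fintype κ] [Fintype μ]
    (N : Matrix κ μ ℤ) (h : ∀ y, N *ᵥ y = 0 → y = 0) (x : μ → ℂ)
    (hx : N.map (Int.cast : ℤ → ℂ) *ᵥ x = 0) : x = 0 := by
  classical
  have hdet := N.det_transpose_mul_self_ne_zero_of_injective h
  have hmap : ((Nᵀ * N).map (Int.cast : ℤ → ℂ)).det ≠ 0 := by
    have := (Int.castRingHom ℂ).map_det (Nᵀ * N)
    intro h0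
    apply hdet
    have h1 : (Int.castRingHom ℂ) (Nᵀ * N).det = 0 := this.trans h0
    simpa using h1
  by_contra hx0
  refine hmap (Matrix.exists_mulVec_eq_zero_iff.1 ⟨x, hx0, ?_⟩)
  have : (Nᵀ * N).map (Int.cast : ℤ → ℂ) =
      Nᵀ.map (Int.cast : ℤ → ℂ) * N.map (Int.cast : ℤ → ℂ) :=
    Matrix.map_mul (f := Int.castRingHom ℂ)
  rw [this, ← mulVec_mulVec, hx, mulVec_zero]

/-- An integer matrix has the same kernel as some integer matrix with a right inverse. -/
theorem Matrix.exists_mul_eq_one_and_ker_eq {κ ι : Type*} [Fintype κ] [Fintype ι]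
    (M : Matrix κ ι ℤ) :
    ∃ (m : ℕ) (B : Matrix (Fin m) ι ℤ) (E : Matrix ι (Fin m) ℤ), B * E = 1 ∧
      ∀ v, B *ᵥ v = 0 ↔ M *ᵥ v = 0 := by
  classical
  obtain ⟨m, b⟩ := Submodule.basisOfPid (Pi.basisFun ℤ κ) (LinearMap.range M.mulVecLin)
  let g : (ι → ℤ) →ₗ[ℤ] (Fin m → ℤ) := b.equivFun.toLinearMap ∘ₗ M.mulVecLin.rangeRestrict
  have hg : Function.Surjective g :=
    b.equivFun.surjective.comp M.mulVecLin.surjective_rangeRestrict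
  obtain ⟨e, he⟩ := Module.projective_lifting_property g LinearMap.id hg
  refine ⟨m, LinearMap.toMatrix' g, LinearMap.toMatrix' e, ?_, fun v => ?_⟩
  · rw [← LinearMap.toMatrix'_comp, he, LinearMap.toMatrix'_id]
  · rw [← Matrix.toLin'_apply, Matrix.toLin'_toMatrix']
    simp only [g, LinearMap.comp_apply, LinearEquiv.coe_coe, EmbeddingLike.map_eq_zero_iff]
    rw [← Submodule.coe_eq_zero]
    rfl

theorem Matrix.map_intCast_mulVec_eq_zero_of_ker_le {κ ι μ : Type*} [Fintype κ] [Fintype ι]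
    [Fintype μ] [DecidableEq μ] {M : Matrix κ ι ℤ} {B : Matrix μ ι ℤ} {E : Matrix ι μ ℤ}
    (hBE : B * E = 1) (hker : ∀ v, B *ᵥ v = 0 ↔ M *ᵥ v = 0) (x : ι → ℂ) :
    B.map (Int.cast : ℤ → ℂ) *ᵥ x = 0 ↔ M.map (Int.cast : ℤ → ℂ) *ᵥ x = 0 := by
  classical
  have hM : M = M * E * B := by
    have : ∀ v, M *ᵥ v = (M * E * B) *ᵥ v := fun v => by
      have h1 : B *ᵥ (v - E *ᵥ B *ᵥ v) = 0 := by
        rw [mulVec_sub, mulVec_mulVec, mulVec_mulVec, hBE, Matrix.one_mul, sub_self]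
      have h2 := (hker _).1 h1
      rw [mulVec_sub, sub_eq_zero] at h2
      rw [h2, mulVec_mulVec, mulVec_mulVec, Matrix.mul_assoc]
    exact Matrix.toLin'.injective (LinearMap.ext this)
  have hinj : ∀ y, (M * E) *ᵥ y = 0 → y = 0 := fun y hy => by
    rw [← mulVec_mulVec, ← hker, mulVec_mulVec, hBE, one_mulVec] at hy
    exact hy
  have hmap : M.map (Int.cast : ℤ → ℂ) =
      (M * E).map (Int.cast : ℤ → ℂ) * B.map (Int.cast : ℤ → ℂ) := by
    conv_lhs => rw [hM]
    exact Matrix.map_mul (f := Int.castRingHom ℂ)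
  rw [hmap, ← mulVec_mulVec]
  exact ⟨fun h => by rw [h, mulVec_zero],
    fun h => Matrix.eq_zero_of_map_intCast_mulVec_eq_zero _ hinj _ h⟩

/-- Integer coordinates on the lattice spanned by the columns of `A` with a row of ones added. -/
theorem exists_lattice_coordinates {κ ι : Type*} [Fintype κ] [Fintype ι] (A : κ → ι → ℤ) :
    ∃ (m : ℕ) (B : Matrix (Fin m) ι ℤ) (E : Matrix ι (Fin m) ℤ) (l : Fin m → ℤ), B * E = 1 ∧
      (∀ j, ∑ k, l k * B k j = 1) ∧
      (∀ v : ι → ℤ, (∀ k, ∑ j, B k j * v j = 0) ↔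
        (∀ i, ∑ j, A i j * v j = 0) ∧ ∑ j, v j = 0) ∧
      ∀ x : ι → ℂ, (∀ k, ∑ j, (B k j : ℂ) * x j = 0) ↔
        (∀ i, ∑ j, (A i j : ℂ) * x j = 0) ∧ ∑ j, x j = 0 := by
  classical
  let M : Matrix (Option κ) ι ℤ := fun o j => o.elim 1 fun i => A i j
  obtain ⟨m, B, E, hBE, hker⟩ := M.exists_mul_eq_one_and_ker_eq
  have hv : ∀ v : ι → ℤ, (∀ k, ∑ j, B k j * v j = 0) ↔
        (∀ i, ∑ j, A i j * v j = 0) ∧ ∑ j, v j = 0 := fun v => by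
    have := hker v
    simp only [funext_iff, mulVec, dotProduct, Pi.zero_apply, Option.forall, M, Option.elim_none,
      Option.elim_some, one_mul] at this
    rw [this, and_comm]
  refine ⟨m, B, E, fun k => ∑ i, E i k, hBE, fun j => ?_, hv, fun x => ?_⟩
  · have h1 := ((hv (Pi.single j 1 - E *ᵥ B *ᵥ Pi.single j 1)).1 ?_).2
    · simp only [Pi.sub_apply, Finset.sum_sub_distrib, sub_eq_zero, mulVec_single_one, mulVec,
        dotProduct, col_apply] at h1
      simp only [Finset.sum_mul]
      rw [Finset.sum_comm, ← h1]
      simp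
    · have h2 : B *ᵥ (Pi.single j 1 - E *ᵥ B *ᵥ Pi.single j 1) = 0 := by
        rw [mulVec_sub, mulVec_mulVec, mulVec_mulVec, hBE, Matrix.one_mul, sub_self]
      exact fun k => congrFun h2 k
  · have := Matrix.map_intCast_mulVec_eq_zero_of_ker_le hBE hker x
    simp only [funext_iff, mulVec, dotProduct, Pi.zero_apply, Option.forall,
      Matrix.map_apply] at this
    simp only [M, Option.elim_none, Option.elim_some, one_mul, Int.cast_one] at this
    rw [this, and_comm]

end Lattice

section Torus

/-- The monomials in `t` whose exponents are the columns of `M`. -/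
noncomputable def monomialMap {κ ι : Type*} [Fintype κ] (M : Matrix κ ι ℤ) (t : κ → ℂ) (j : ι) : ℂ :=
  ∏ k, t k ^ M k j

variable {κ ι μ : Type*} [Fintype κ] [Fintype ι]

omit [Fintype κ] in
theorem prod_zpow_eq_zpow_sum {s : ℂ} (hs : s ≠ 0) (v : ι → ℤ) : ∏ j, s ^ v j = s ^ ∑ j, v j := by
  classical
  induction (Finset.univ : Finset ι) using Finset.induction_on with
  | empty => simp
  | insert j T hj ih => rw [Finset.prod_insert hj, Finset.sum_insert hj, zpow_add₀ hs, ih]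

omit [Fintype ι] in
theorem monomialMap_ne_zero (M : Matrix κ ι ℤ) {t : κ → ℂ} (ht : ∀ k, t k ≠ 0) (j : ι) :
    monomialMap M t j ≠ 0 :=
  Finset.prod_ne_zero_iff.2 fun k _ => zpow_ne_zero _ (ht k)

theorem prod_zpow_zpow_eq {t : κ → ℂ} (ht : ∀ k, t k ≠ 0) (M : Matrix κ ι ℤ) (v : ι → ℤ) :
    ∏ j, monomialMap M t j ^ v j = ∏ k, t k ^ ∑ j, M k j * v j := by
  simp only [monomialMap, ← Finset.prod_zpow]
  rw [Finset.prod_comm]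
  refine Finset.prod_congr rfl fun k _ => ?_
  simp only [← zpow_mul]
  exact prod_zpow_eq_zpow_sum (ht k) _

theorem monomialMap_monomialMap {t : κ → ℂ} (ht : ∀ k, t k ≠ 0) (M : Matrix κ ι ℤ)
    (N : Matrix ι μ ℤ) :
    monomialMap N (monomialMap M t) = monomialMap (M * N) t :=
  funext fun l => prod_zpow_zpow_eq ht M fun j => N j l

theorem monomialMap_one [DecidableEq κ] (t : κ → ℂ) : monomialMap (1 : Matrix κ κ ℤ) t = t := by
  funext j
  rw [monomialMap, Finset.prod_eq_single j] <;> simp +contextual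

theorem prod_pow_toNat_eq_iff {p : ι → ℂ} (hp : ∀ j, p j ≠ 0) (v : ι → ℤ) :
    (∏ j, p j ^ (max (v j) 0).toNat) = (∏ j, p j ^ (max (-v j) 0).toNat) ↔
      ∏ j, p j ^ v j = 1 := by
  have h : ∏ j, p j ^ v j =
      (∏ j, p j ^ (max (v j) 0).toNat) / (∏ j, p j ^ (max (-v j) 0).toNat) := by
    rw [← Finset.prod_div_distrib]
    refine Finset.prod_congr rfl fun j _ => ?_
    rw [← zpow_natCast, ← zpow_natCast, ← zpow_sub₀ (hp j)]
    congr 1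
    omega
  rw [h, div_eq_one_iff_eq (Finset.prod_ne_zero_iff.2 fun j _ => pow_ne_zero _ (hp j))]

/-- The points of the torus at which the moment vector `B (c * t ^ B)` equals `w`. -/
def momentFiber (B : Matrix κ ι ℤ) (c : ι → ℂ) (w : κ → ℂ) : Set (κ → ℂ) :=
  {t | (∀ k, t k ≠ 0) ∧ ∀ k, ∑ j, (B k j : ℂ) * (c j * monomialMap B t j) = w k}

theorem monomialMap_eq_self_of_prod_zpow_eq_one [DecidableEq κ] [DecidableEq ι]
    {B : Matrix κ ι ℤ} {E : Matrix ι κ ℤ}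
    (hBE : B * E = 1) {q : ι → ℂ} (hq0 : ∀ j, q j ≠ 0)
    (hq : ∀ v : ι → ℤ, (∀ k, ∑ j, B k j * v j = 0) → ∏ j, q j ^ v j = 1) :
    monomialMap B (monomialMap E q) = q := by
  rw [monomialMap_monomialMap hq0]
  funext j
  let v : Matrix ι ι ℤ := 1 - E * B
  have h1 : ∏ i, q i ^ v i j = 1 := hq (fun i => v i j) fun k => by
    have : (B * v) k j = 0 := by
      rw [Matrix.mul_sub, ← Matrix.mul_assoc, hBE]
      simp
    exact this
  have h2 : ∏ i, q i ^ v i j = monomialMap (1 : Matrix ι ι ℤ) q j / monomialMap (E * B) q j := by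
    rw [monomialMap, monomialMap, ← Finset.prod_div_distrib]
    exact Finset.prod_congr rfl fun i _ => zpow_sub₀ (hq0 i) _ _
  rw [h1, monomialMap_one, eq_comm, div_eq_one_iff_eq (monomialMap_ne_zero _ hq0 j)] at h2
  exact h2.symm

/-- The solutions of the likelihood system correspond to the points of a fibre of the moment map. -/
theorem bijOn_momentFiber_mlSolutions [DecidableEq μ] {A : κ → ι → ℤ} [Fintype μ]
    {B : Matrix μ ι ℤ} {E : Matrix ι μ ℤ} (hBE : B * E = 1)
    (hker : ∀ v : ι → ℤ, (∀ k, ∑ j, B k j * v j = 0) ↔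
        (∀ i, ∑ j, A i j * v j = 0) ∧ ∑ j, v j = 0)
    (hkerC : ∀ x : ι → ℂ, (∀ k, ∑ j, (B k j : ℂ) * x j = 0) ↔
        (∀ i, ∑ j, (A i j : ℂ) * x j = 0) ∧ ∑ j, x j = 0)
    (c u : ι → ℂ) (hu : ∑ j, u j ≠ 0) :
    Set.BijOn (fun t j => (∑ i, u i)⁻¹ * monomialMap B t j)
      (momentFiber B c fun k => ∑ j, (B k j : ℂ) * u j) (mlSolutions A c u) := by
  classical
  set U := ∑ i, u i with hU
  have hmom : ∀ q : ι → ℂ, (∀ k, ∑ j, (B k j : ℂ) * (c j * q j) = ∑ j, (B k j : ℂ) * u j) ↔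
      (∀ i, ∑ j, (A i j : ℂ) * (c j * q j) = ∑ j, (A i j : ℂ) * u j) ∧ ∑ j, c j * q j = U := by
    intro q
    have := hkerC fun j => c j * q j - u j
    simpa only [mul_sub, Finset.sum_sub_distrib, sub_eq_zero] using this
  have hscale : ∀ (s : ℂ) (hs : s ≠ 0) (q : ι → ℂ) (v : ι → ℤ), ∑ j, v j = 0 →
      ∏ j, (s * q j) ^ v j = ∏ j, q j ^ v j := by
    intro s hs q v hv
    simp only [mul_zpow, Finset.prod_mul_distrib]
    have : ∏ j, s ^ v j = s ^ ∑ j, v j := prod_zpow_eq_zpow_sum hs v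
    rw [this, hv, zpow_zero, one_mul]
  refine ⟨?_, ?_, ?_⟩
  · rintro t ⟨ht, hw⟩
    have hne := fun j => mul_ne_zero (inv_ne_zero hu) (monomialMap_ne_zero B ht j)
    obtain ⟨h1, h2⟩ := (hmom _).1 hw
    refine ⟨hne, fun v hv hv0 => ?_, ?_, fun i => ?_⟩
    · rw [prod_pow_toNat_eq_iff hne, hscale _ (inv_ne_zero hu) _ _ hv0, prod_zpow_zpow_eq ht]
      have := (hker v).2 ⟨hv, hv0⟩
      simp [this]
    · simp only [mul_left_comm (c _), ← Finset.mul_sum, h2]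
      exact inv_mul_cancel₀ hu
    · change U * _ = _
      rw [← h1, Finset.mul_sum]
      exact Finset.sum_congr rfl fun j _ => by field_simp
  · rintro t ⟨ht, _⟩ t' ⟨ht', _⟩ h
    have h1 : monomialMap B t = monomialMap B t' := funext fun j =>
      mul_left_cancel₀ (inv_ne_zero hu) (congrFun h j)
    rw [← monomialMap_one t, ← monomialMap_one t', ← hBE, ← monomialMap_monomialMap ht,
      ← monomialMap_monomialMap ht', h1]
  · rintro p ⟨hp, hbin, hsum, hA⟩
    have hq0 : ∀ j, U * p j ≠ 0 := fun j => mul_ne_zero hu (hp j)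
    have hq := monomialMap_eq_self_of_prod_zpow_eq_one hBE hq0 fun v hv => by
      obtain ⟨hv1, hv2⟩ := (hker v).1 hv
      rw [hscale _ hu _ _ hv2, ← prod_pow_toNat_eq_iff hp]
      exact hbin v hv1 hv2
    refine ⟨monomialMap E fun j => U * p j, ⟨monomialMap_ne_zero E hq0, ?_⟩, ?_⟩
    · rw [hq, hmom]
      refine ⟨fun i => ?_, ?_⟩
      · rw [← hA i, Finset.mul_sum]
        exact Finset.sum_congr rfl fun j _ => by ring
      · simp only [mul_left_comm (c _), ← Finset.mul_sum, hsum, mul_one]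
    · funext j
      simp only [hq]
      rw [inv_mul_cancel_left₀ hu]

end Torus

section MomentMap

open Topology Filter

theorem MvPolynomial.eq_zero_of_eventually_eval_eq_zero {σ : Type*} [Finite σ]
    (f : MvPolynomial σ ℂ) (x : σ → ℂ) (h : ∀ᶠ y in 𝓝 x, eval y f = 0) : f = 0 := by
  obtain ⟨U, hU, hsub⟩ : ∃ U : σ → Set ℂ, (∀ i, U i ∈ 𝓝 (x i)) ∧
      ∀ y ∈ Set.univ.pi U, eval y f = 0 := by
    rw [nhds_pi, Filter.eventually_iff, Filter.mem_pi'] at h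
    obtain ⟨I, U, hU, hI⟩ := h
    exact ⟨U, hU, fun y hy => hI fun i _ => hy i trivial⟩
  refine MvPolynomial.funext_set U (fun i => infinite_of_mem_nhds (x i) (hU i)) fun y hy => ?_
  rw [hsub y hy, map_zero]

variable {κ ι : Type*} [Fintype κ] [Fintype ι]

/-- The moment map in logarithmic coordinates. -/
noncomputable def logMoment (B : Matrix κ ι ℤ) (c : ι → ℂ) (z : κ → ℂ) (k : κ) : ℂ :=
  ∑ j, (B k j : ℂ) * (c j * Complex.exp (∑ l, (B l j : ℂ) * z l))

/-- The derivative of the moment map at `z` is injective. -/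
def LogMomentRegular (B : Matrix κ ι ℤ) (c : ι → ℂ) (z : κ → ℂ) : Prop :=
  ∀ v : κ → ℂ, (∀ k, ∑ j, (B k j : ℂ) * (c j * (Complex.exp (∑ l, (B l j : ℂ) * z l) *
    ∑ l, (B l j : ℂ) * v l)) = 0) → v = 0

omit [Fintype ι] in
theorem monomialMap_exp (B : Matrix κ ι ℤ) (z : κ → ℂ) (j : ι) :
    monomialMap B (fun k => Complex.exp (z k)) j = Complex.exp (∑ l, (B l j : ℂ) * z l) := by
  simp only [monomialMap, Complex.exp_sum, ← Complex.exp_int_mul]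

theorem hasDerivAt_logMoment (B : Matrix κ ι ℤ) (c : ι → ℂ) (z v : κ → ℂ) (k : κ) :
    HasDerivAt (fun s : ℂ => logMoment B c (z + s • v) k)
      (∑ j, (B k j : ℂ) * (c j * (Complex.exp (∑ l, (B l j : ℂ) * z l) *
        ∑ l, (B l j : ℂ) * v l))) 0 := by
  unfold logMoment
  refine HasDerivAt.fun_sum fun j _ => ((HasDerivAt.const_mul _ ?_).const_mul _)
  have h : HasDerivAt (fun s : ℂ => ∑ l, (B l j : ℂ) * (z + s • v) l)
      (∑ l, (B l j : ℂ) * v l) 0 := by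
    refine HasDerivAt.fun_sum fun l _ => HasDerivAt.const_mul _ ?_
    simpa using ((hasDerivAt_id (0 : ℂ)).mul_const (v l)).const_add (z l)
  simpa using h.cexp

theorem map_nhds_logMoment_of_regular {B : Matrix κ ι ℤ} {c : ι → ℂ} {z : κ → ℂ}
    (h : LogMomentRegular B c z) :
    Filter.map (fun x : (ι → ℂ) × (κ → ℂ) => (x.1, logMoment B x.1 x.2)) (𝓝 (c, z)) =
      𝓝 (c, logMoment B c z) := by
  set Ψ : (ι → ℂ) × (κ → ℂ) → (ι → ℂ) × (κ → ℂ) := fun x => (x.1, logMoment B x.1 x.2) with hΨ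
  have hsmooth : ContDiff ℂ 1 Ψ := by
    unfold Ψ logMoment
    fun_prop
  have hd : HasStrictFDerivAt Ψ (fderiv ℂ Ψ (c, z)) (c, z) :=
    hsmooth.contDiffAt.hasStrictFDerivAt (by simp)
  refine hd.map_nhds_eq_of_surj ?_
  have hinj : Function.Injective (fderiv ℂ Ψ (c, z)) := by
    refine (injective_iff_map_eq_zero _).2 fun ⟨dc, dz⟩ h0 => ?_
    have hcurve : HasDerivAt (fun s : ℂ => Ψ ((c, z) + s • (dc, dz))) 0 0 := by
      have h1 : HasDerivAt (fun s : ℂ => (c, z) + s • (dc, dz)) (dc, dz) 0 := by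
        simpa using ((hasDerivAt_id (0 : ℂ)).smul_const (dc, dz)).const_add (c, z)
      have h2 : HasFDerivAt Ψ (fderiv ℂ Ψ (c, z)) ((c, z) + (0 : ℂ) • (dc, dz)) := by
        simpa using hd.hasFDerivAt
      have h3 := h2.comp_hasDerivAt (0 : ℂ) h1
      rwa [h0] at h3
    have hdc : dc = 0 := by
      have h1 := hcurve.fst
      have h2 : HasDerivAt (fun s : ℂ => c + s • dc) dc 0 := by
        simpa using ((hasDerivAt_id (0 : ℂ)).smul_const dc).const_add c
      exact h2.unique h1
    subst hdc
    have hdz : dz = 0 := by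
      refine h dz fun k => ?_
      have h1 := (hasDerivAt_pi.1 hcurve.snd) k
      simp only [hΨ, Prod.mk_add_mk, Prod.smul_mk, smul_zero, add_zero] at h1
      exact (hasDerivAt_logMoment B c z dz k).unique h1
    rw [hdz]
    rfl
  exact LinearMap.range_eq_top.2 (LinearMap.injective_iff_surjective.1 hinj)

/-- A regular point of a fibre of the moment map persists when the scaling moves a little. -/
theorem LogMomentRegular.eventually_exists {B : Matrix κ ι ℤ} {c : ι → ℂ} {z : κ → ℂ}
    (h : LogMomentRegular B c z) {V : Set (κ → ℂ)} (hV : V ∈ 𝓝 z) :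
    ∀ᶠ c' in 𝓝 c, ∃ z' ∈ V, logMoment B c' z' = logMoment B c z := by
  have h1 : (fun x : (ι → ℂ) × (κ → ℂ) => (x.1, logMoment B x.1 x.2)) '' (Set.univ ×ˢ V) ∈
      𝓝 (c, logMoment B c z) := by
    rw [← map_nhds_logMoment_of_regular h]
    exact image_mem_map (prod_mem_nhds univ_mem hV)
  filter_upwards [(Continuous.prodMk_left (logMoment B c z)).continuousAt.preimage_mem_nhds h1]
  rintro c' ⟨⟨c'', z'⟩, ⟨-, hz'⟩, heq⟩
  simp only [Prod.mk.injEq] at heq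
  obtain ⟨rfl, heq⟩ := heq
  exact ⟨z', hz', heq⟩

theorem logMomentRegular_one_zero [DecidableEq κ] {B : Matrix κ ι ℤ} {E : Matrix ι κ ℤ}
    (hBE : B * E = 1) : LogMomentRegular B (fun _ => 1) 0 := by
  have hinj : ∀ y, B.transpose.mulVec y = 0 → y = 0 := fun y hy => by
    have h1 := congrArg E.transpose.mulVec hy
    rw [Matrix.mulVec_mulVec, ← Matrix.transpose_mul, hBE, Matrix.transpose_one,
      Matrix.one_mulVec, Matrix.mulVec_zero] at h1
    exact h1
  have hdet := Matrix.det_transpose_mul_self_ne_zero_of_injective _ hinj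
  intro v hv
  refine (B * B.transpose).eq_zero_of_map_intCast_mulVec_eq_zero (fun y hy => ?_) v ?_
  · by_contra hy0
    exact hdet (Matrix.exists_mulVec_eq_zero_iff.1 ⟨y, hy0, hy⟩)
  · have hmap : (B * B.transpose).map (Int.cast : ℤ → ℂ) =
        B.map (Int.cast : ℤ → ℂ) * B.transpose.map (Int.cast : ℤ → ℂ) :=
      Matrix.map_mul (f := Int.castRingHom ℂ)
    rw [hmap, ← Matrix.mulVec_mulVec]
    funext k
    simpa [Matrix.mulVec, dotProduct] using hv k

/-- A polynomial vanishing on the graph of the family of all moment maps is zero. -/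
theorem eq_zero_of_eval_logMoment_eq_zero [DecidableEq κ] {B : Matrix κ ι ℤ} {E : Matrix ι κ ℤ}
    (hBE : B * E = 1) (f : MvPolynomial (ι ⊕ κ) ℂ)
    (h : ∀ c z, MvPolynomial.eval (Sum.elim c (logMoment B c z)) f = 0) : f = 0 := by
  have h1 := map_nhds_logMoment_of_regular (logMomentRegular_one_zero hBE)
  have h2 : ∀ᶠ y in 𝓝 ((fun _ => 1 : ι → ℂ), logMoment B (fun _ => 1) 0),
      MvPolynomial.eval (Sum.elim y.1 y.2) f = 0 := by
    rw [← h1, eventually_map]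
    exact Eventually.of_forall fun x => h x.1 x.2
  refine f.eq_zero_of_eventually_eval_eq_zero
    (Sum.elim (fun _ => 1) (logMoment B (fun _ => 1) 0)) ?_
  have hcont : Continuous fun y : ι ⊕ κ → ℂ => (y ∘ Sum.inl, y ∘ Sum.inr) := by fun_prop
  filter_upwards [hcont.continuousAt.eventually h2] with y hy
  simpa [Sum.elim_comp_inl_inr] using hy

end MomentMap

section GenericFibers

open MvPolynomial

/-- A Laurent monomial as a function on the locus where the relevant coordinates do not vanish. -/
noncomputable def laurentMonomial {τ κ ι : Type} [Fintype κ] (s : κ → τ) (B : Matrix κ ι ℤ)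
    (j : ι) : Localization.Away (∏ k, X (s k) : MvPolynomial τ ℂ) :=
  ↑(∏ k, IsUnit.unit (isUnit_of_dvd_unit
    (map_dvd (algebraMap _ (Localization.Away (∏ k, X (s k) : MvPolynomial τ ℂ)))
      (Finset.dvd_prod_of_mem (fun k => (X (s k) : MvPolynomial τ ℂ)) (Finset.mem_univ k)))
    (IsLocalization.Away.algebraMap_isUnit _)) ^ B k j)

theorem algHom_laurentMonomial {τ κ ι : Type} [Fintype κ] (s : κ → τ) (B : Matrix κ ι ℤ) (j : ι)
    (ψ : Localization.Away (∏ k, X (s k) : MvPolynomial τ ℂ) →ₐ[ℂ] ℂ) :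
    ψ (laurentMonomial s B j) = monomialMap B (fun k => ψ (algebraMap (MvPolynomial τ ℂ)
      (Localization.Away (∏ k, X (s k) : MvPolynomial τ ℂ)) (X (s k)))) j := by
  refine (Units.coe_map (MonoidHomClass.toMonoidHom ψ) _).symm.trans ?_
  rw [map_prod, Units.coe_prod]
  refine Finset.prod_congr rfl fun k _ => ?_
  rw [map_zpow, Units.val_zpow_eq_zpow_val]
  rfl

variable {κ ι : Type} [Fintype κ] [Fintype ι]

theorem eval_prod_X_ne_zero_iff {τ : Type} (s : κ → τ) (x : τ → ℂ) :
    eval x (∏ k, X (s k) : MvPolynomial τ ℂ) ≠ 0 ↔ ∀ k, x (s k) ≠ 0 := by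
  simp [map_prod, Finset.prod_ne_zero_iff]

theorem mem_momentFiber_exp {B : Matrix κ ι ℤ} {c : ι → ℂ} {w : κ → ℂ} {z : κ → ℂ} :
    (fun k => Complex.exp (z k)) ∈ momentFiber B c w ↔ logMoment B c z = w := by
  simp only [momentFiber, Set.mem_ofPred_eq, Complex.exp_ne_zero, not_false_eq_true, implies_true,
    true_and, ne_eq, monomialMap_exp, _root_.funext_iff, logMoment]

/-- For almost all scalings and values the fibre of the moment map has the same positive number of
points. -/
theorem exists_ncard_momentFiber_of_scaling [DecidableEq κ] {B : Matrix κ ι ℤ} {E : Matrix ι κ ℤ}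
    (hBE : B * E = 1) :
    ∃ (N : ℕ) (f : MvPolynomial (ι ⊕ κ) ℂ), 0 < N ∧ f ≠ 0 ∧
      ∀ c w, eval (Sum.elim c w) f ≠ 0 →
        (momentFiber B c w).Finite ∧ (momentFiber B c w).ncard = N := by
  let s : κ → ι ⊕ κ := Sum.inr
  let S := Localization.Away (∏ k, X (s k) : MvPolynomial (ι ⊕ κ) ℂ)
  let y : ι ⊕ κ → S := Sum.elim
    (fun j => algebraMap (MvPolynomial (ι ⊕ κ) ℂ) S (X (Sum.inl j)))
    (fun k => ∑ j, algebraMap ℂ S (B k j) *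
      (algebraMap (MvPolynomial (ι ⊕ κ) ℂ) S (X (Sum.inl j)) * laurentMonomial s B j))
  let Y : (ι ⊕ κ → ℂ) → ι ⊕ κ → ℂ := fun x => Sum.elim (fun j => x (Sum.inl j))
    (fun k => ∑ j, (B k j : ℂ) * (x (Sum.inl j) * monomialMap B (fun l => x (Sum.inr l)) j))
  have hY : ∀ (ψ : S →ₐ[ℂ] ℂ) i,
      ψ (y i) = Y (fun k => ψ (algebraMap (MvPolynomial (ι ⊕ κ) ℂ) S (X k))) i := by
    rintro ψ (j | k)
    · rfl
    · simp only [y, Y, Sum.elim_inr, map_sum, map_mul, AlgHom.commutes]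
      exact Finset.sum_congr rfl fun j _ => by rw [algHom_laurentMonomial]; rfl
  have hπ : (∏ k, X (s k) : MvPolynomial (ι ⊕ κ) ℂ) ≠ 0 :=
    Finset.prod_ne_zero_iff.2 fun k _ => X_ne_zero _
  have hdom : ∀ f : MvPolynomial (ι ⊕ κ) ℂ,
      (∀ x, eval x (∏ k, X (s k)) ≠ 0 → eval (Y x) f = 0) → f = 0 := by
    refine fun f hf => eq_zero_of_eval_logMoment_eq_zero hBE f fun c z => ?_
    have := hf (Sum.elim c fun k => Complex.exp (z k))
      ((eval_prod_X_ne_zero_iff s _).2 fun k => Complex.exp_ne_zero _)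
    simp only [Y, Sum.elim_inl, Sum.elim_inr, monomialMap_exp] at this
    exact this
  obtain ⟨N, f, hN, hf, h⟩ := exists_ncard_fiber_of_dominant hπ hY hdom
  refine ⟨N, f, hN, hf, fun c w hw => ?_⟩
  have himg : {x | eval x (∏ k, X (s k)) ≠ 0 ∧ Y x = Sum.elim c w} =
      Sum.elim c '' momentFiber B c w := by
    ext x
    simp only [eval_prod_X_ne_zero_iff, Set.mem_ofPred_eq, Set.mem_image, momentFiber]
    constructor
    · rintro ⟨hx, hYx⟩
      have hc : c = fun j => x (Sum.inl j) := funext fun j => (congrFun hYx (Sum.inl j)).symm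
      refine ⟨fun k => x (Sum.inr k), ⟨hx, fun k => ?_⟩, ?_⟩
      · rw [hc]
        exact congrFun hYx (Sum.inr k)
      · rw [hc]
        exact Sum.elim_comp_inl_inr x
    · rintro ⟨t, ⟨ht, hw⟩, rfl⟩
      refine ⟨ht, ?_⟩
      funext i
      rcases i with j | k
      · rfl
      · exact hw k
  have hinj : Function.Injective (Sum.elim c : (κ → ℂ) → _) := fun t t' h =>
    funext fun k => congrFun h (Sum.inr k)
  have := h (Sum.elim c w) hw
  rwa [himg, Set.finite_image_iff hinj.injOn, Set.ncard_image_of_injective _ hinj] at this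

theorem hasDerivAt_eval_of_stationary {σ : Type*} (a : MvPolynomial σ ℂ) {w : ℂ → σ → ℂ}
    (hw : ∀ k, HasDerivAt (fun s => w s k) 0 0) : HasDerivAt (fun s => eval (w s) a) 0 0 := by
  induction a using MvPolynomial.induction_on with
  | C z => simpa using hasDerivAt_const (0 : ℂ) z
  | add p q hp hq => simpa using hp.fun_add hq
  | mul_X p k hp => simpa using hp.fun_mul (hw k)

theorem hasDerivAt_eval_map_of_stationary {σ : Type*} (M : Polynomial (MvPolynomial σ ℂ))
    {w : ℂ → σ → ℂ} (hw : ∀ k, HasDerivAt (fun s => w s k) 0 0) {g : ℂ → ℂ} {g' : ℂ}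
    (hg : HasDerivAt g g' 0) :
    HasDerivAt (fun s => (M.map (eval (w s))).eval (g s))
      ((M.derivative.map (eval (w 0))).eval (g 0) * g') 0 := by
  induction M using Polynomial.induction_on' with
  | add p q hp hq => simpa [add_mul] using hp.fun_add hq
  | monomial n a =>
    have := (hasDerivAt_eval_of_stationary a hw).fun_mul (hg.fun_pow n)
    simpa [Polynomial.derivative_monomial, mul_assoc] using this

/-- For almost all values the fibre of a fixed moment map has the same number of points, and all of
them are regular. -/
theorem exists_ncard_momentFiber (B : Matrix κ ι ℤ) (c : ι → ℂ) :
    ∃ (N : ℕ) (f : MvPolynomial κ ℂ), f ≠ 0 ∧ ∀ w, eval w f ≠ 0 →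
      (momentFiber B c w).Finite ∧ (momentFiber B c w).ncard = N ∧
        ∀ z, logMoment B c z = w → LogMomentRegular B c z := by
  let s : κ → κ := id
  let S := Localization.Away (∏ k, X (s k) : MvPolynomial κ ℂ)
  let y : κ → S := fun k => ∑ j, algebraMap ℂ S (B k j) * (algebraMap ℂ S (c j) * laurentMonomial s B j)
  let Y : (κ → ℂ) → κ → ℂ := fun t k => ∑ j, (B k j : ℂ) * (c j * monomialMap B t j)
  have hY : ∀ (ψ : S →ₐ[ℂ] ℂ) i,
      ψ (y i) = Y (fun k => ψ (algebraMap (MvPolynomial κ ℂ) S (X k))) i := by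
    intro ψ k
    simp only [y, Y, map_sum, map_mul, AlgHom.commutes]
    exact Finset.sum_congr rfl fun j _ => by rw [algHom_laurentMonomial]; rfl
  have hπ : (∏ k, X (s k) : MvPolynomial κ ℂ) ≠ 0 :=
    Finset.prod_ne_zero_iff.2 fun k _ => X_ne_zero _
  have hfib : ∀ w, {x | eval x (∏ k, X (s k)) ≠ 0 ∧ Y x = w} = momentFiber B c w := by
    intro w
    ext t
    have := eval_prod_X_ne_zero_iff s t
    simp only [Set.mem_ofPred_eq, momentFiber, _root_.funext_iff, Y, this]
    rfl
  by_cases hdom : ∀ f : MvPolynomial κ ℂ,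
      (∀ x, eval x (∏ k, X (s k)) ≠ 0 → eval (Y x) f = 0) → f = 0
  · obtain ⟨N, f, -, hf, h⟩ := exists_ncard_fiber_of_dominant hπ hY hdom
    choose M e he hM using exists_separable_equation_of_dominant hπ hY hdom
    refine ⟨N, f * ∏ k, e k, mul_ne_zero hf (Finset.prod_ne_zero_iff.2 fun k _ => he k),
      fun w hw => ?_⟩
    rw [map_mul, map_prod, mul_ne_zero_iff, Finset.prod_ne_zero_iff] at hw
    have h1 := h w hw.1
    rw [hfib] at h1
    refine ⟨h1.1, h1.2, fun z hz v hv => ?_⟩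
    funext k
    have hYz : ∀ z, Y (fun k => Complex.exp (z k)) = logMoment B c z := fun z => by
      funext k
      simp only [Y, monomialMap_exp, logMoment]
    have hne : ∀ z : κ → ℂ, eval (fun k => Complex.exp (z k)) (∏ k, X (s k)) ≠ 0 :=
      fun z => (eval_prod_X_ne_zero_iff s _).2 fun k => Complex.exp_ne_zero _
    have hst : ∀ k, HasDerivAt (fun a : ℂ => logMoment B c (z + a • v) k) 0 0 := fun k => by
      have := hasDerivAt_logMoment B c z v k
      rwa [hv k] at this
    have hg : HasDerivAt (fun a : ℂ => Complex.exp ((z + a • v) k))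
        (Complex.exp (z k) * v k) 0 := by
      have h2 : HasDerivAt (fun a : ℂ => (z + a • v) k) (v k) 0 := by
        simpa using ((hasDerivAt_id (0 : ℂ)).mul_const (v k)).const_add (z k)
      simpa using h2.cexp
    have h3 := hasDerivAt_eval_map_of_stationary (M k) hst hg
    have h4 : (fun a : ℂ => ((M k).map (eval (logMoment B c (z + a • v)))).eval
        (Complex.exp ((z + a • v) k))) = fun _ => 0 := by
      funext a
      rw [← hYz]
      exact (hM k _ (hne _)).1
    rw [h4] at h3
    have h5 := h3.unique (hasDerivAt_const _ _)
    have h6 := (hM k _ (hne z)).2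
    rw [hYz, hz] at h6
    simp only [zero_smul, add_zero, hz, mul_eq_zero, Complex.exp_ne_zero, false_or] at h5
    exact h5.resolve_left (h6 (hw.2 k (Finset.mem_univ k)))
  · push Not at hdom
    obtain ⟨f, hf, hf0⟩ := hdom
    have hempty : ∀ w, eval w f ≠ 0 → momentFiber B c w = ∅ := by
      intro w hw
      rw [← hfib, Set.eq_empty_iff_forall_notMem]
      rintro x ⟨hx, rfl⟩
      exact hw (hf x hx)
    refine ⟨0, f, hf0, fun w hw => ?_⟩
    rw [hempty w hw]
    refine ⟨Set.finite_empty, Set.ncard_empty _, fun z hz => ?_⟩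
    have := mem_momentFiber_exp.2 hz
    rw [hempty w hw] at this
    exact this.elim

end GenericFibers

section Degeneration

open Topology Filter

variable {κ ι : Type} [Fintype κ] [Fintype ι]

omit [Fintype κ] in
theorem exists_exp_eq {t : κ → ℂ} (ht : ∀ k, t k ≠ 0) :
    ∃ z : κ → ℂ, (fun k => Complex.exp (z k)) = t :=
  ⟨fun k => Complex.log (t k), funext fun k => Complex.exp_log (ht k)⟩

/-- If the moment map of the scaling `c` vanishes somewhere, then near `c` there are scalings with a
prescribed moment fibre containing a point where some monomial is arbitrarily large. -/
theorem exists_degenerating_family {B : Matrix κ ι ℤ} {l : κ → ℤ} (hl : ∀ j, ∑ k, l k * B k j = 1)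
    {c c₁ : ι → ℂ} {z₀ z₁ : κ → ℂ} (h₀ : logMoment B c z₀ = 0)
    (f : MvPolynomial (ι ⊕ κ) ℂ)
    (h₁ : MvPolynomial.eval (Sum.elim c₁ (logMoment B c₁ z₁)) f ≠ 0) :
    ∃ (γ : ℂ → ι → ℂ) (ζ : ℂ → κ → ℂ), Continuous γ ∧ γ 0 = c ∧
      (∀ᶠ ε in 𝓝[≠] 0, MvPolynomial.eval (Sum.elim (γ ε) (logMoment B c₁ z₁)) f ≠ 0) ∧
      (∀ᶠ ε in 𝓝[≠] 0, logMoment B (γ ε) (ζ ε) = logMoment B c₁ z₁) ∧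
      ∀ j, Tendsto (fun ε => ‖Complex.exp (∑ k, (B k j : ℂ) * ζ ε k)‖) (𝓝[≠] 0) atTop := by
  let e : ι → (κ → ℂ) → ℂ := fun j z => Complex.exp (∑ k, (B k j : ℂ) * z k)
  let z : ℂ → κ → ℂ := fun ε => z₀ + ε • (z₁ - z₀)
  let γ : ℂ → ι → ℂ := fun ε j =>
    (c j * e j z₀ + ε * (c₁ j * e j z₁ - c j * e j z₀)) * Complex.exp (-∑ k, (B k j : ℂ) * z ε k)
  let ζ : ℂ → κ → ℂ := fun ε k => z ε k - Complex.log ε * l k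
  have hγ : ∀ j, Differentiable ℂ fun ε => γ ε j := fun j => by
    simp only [γ, z, Pi.add_apply, Pi.smul_apply, smul_eq_mul]
    fun_prop
  have hζ : ∀ ε, ε ≠ 0 → ∀ j, Complex.exp (∑ k, (B k j : ℂ) * ζ ε k) = e j (z ε) / ε := by
    intro ε hε j
    have hlC : ∑ k, (l k : ℂ) * B k j = 1 := by exact_mod_cast hl j
    have : ∑ k, (B k j : ℂ) * ζ ε k = ∑ k, (B k j : ℂ) * z ε k - Complex.log ε := by
      rw [← mul_one (Complex.log ε), ← hlC, Finset.mul_sum, ← Finset.sum_sub_distrib]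
      exact Finset.sum_congr rfl fun k _ => by simp only [ζ]; ring
    rw [this, Complex.exp_sub, Complex.exp_log hε]
  refine ⟨γ, ζ, continuous_pi fun j => (hγ j).continuous, ?_, ?_, ?_, fun j => ?_⟩
  · funext j
    simp [γ, z, e, mul_assoc, ← Complex.exp_add]
  · have han : AnalyticOnNhd ℂ
        (fun ε => MvPolynomial.eval (Sum.elim (γ ε) (logMoment B c₁ z₁)) f) Set.univ := by
      simp only [← MvPolynomial.coe_aeval_eq_eval]
      refine AnalyticOnNhd.aeval_mvPolynomial (fun i => ?_) f
      rcases i with j | k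
      · exact fun ε _ => (hγ j).analyticAt ε
      · exact analyticOnNhd_const
    by_contra hcon
    have hfreq : ∃ᶠ ε in 𝓝[≠] (0 : ℂ),
        MvPolynomial.eval (Sum.elim (γ ε) (logMoment B c₁ z₁)) f = 0 := by
      exact (Filter.not_eventually.1 hcon).mono fun _ h => not_not.1 h
    have h1 : MvPolynomial.eval (Sum.elim (γ 1) (logMoment B c₁ z₁)) f = 0 :=
      han.eqOn_zero_of_preconnected_of_frequently_eq_zero isPreconnected_univ
      (Set.mem_univ 0) hfreq (Set.mem_univ 1)
    have hγ1 : γ 1 = c₁ := by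
      funext j
      simp [γ, z, e, mul_assoc, ← Complex.exp_add]
    exact h₁ (hγ1 ▸ h1)
  · filter_upwards [self_mem_nhdsWithin] with ε hε
    funext k
    have h2 : ∀ j, γ ε j * (e j (z ε) / ε) =
        c j * e j z₀ / ε + (c₁ j * e j z₁ - c j * e j z₀) := by
      intro j
      have : Complex.exp (-∑ k, (B k j : ℂ) * z ε k) * e j (z ε) = 1 := by
        simp [e, ← Complex.exp_add]
      simp only [γ]
      rw [mul_assoc, mul_div_assoc', this]
      field_simp [show ε ≠ 0 from hε]
    have h3 : ∑ j, (B k j : ℂ) * (c j * e j z₀) = 0 := congrFun h₀ k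
    simp only [logMoment, hζ ε hε, h2]
    change _ = ∑ j, (B k j : ℂ) * (c₁ j * e j z₁)
    simp only [mul_add, mul_sub, Finset.sum_add_distrib, Finset.sum_sub_distrib, h3, sub_zero,
      mul_div_assoc', ← Finset.sum_div, zero_div, zero_add]
  · have h1 : Tendsto (fun ε => ‖e j (z ε)‖) (𝓝[≠] 0) (𝓝 ‖e j z₀‖) := by
      have hc : Continuous fun ε => ‖e j (z ε)‖ := by fun_prop
      have := hc.tendsto 0
      simp only [z, zero_smul, add_zero] at this
      exact this.mono_left nhdsWithin_le_nhds
    have h2 : Tendsto (fun ε : ℂ => ‖ε⁻¹‖) (𝓝[≠] 0) atTop :=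
      tendsto_norm_cobounded_atTop.comp tendsto_inv₀_nhdsNE_zero
    have h3 := h1.pos_mul_atTop (norm_pos_iff.2 (Complex.exp_ne_zero _)) h2
    refine h3.congr' ?_
    filter_upwards [self_mem_nhdsWithin] with ε hε
    rw [hζ ε hε, div_eq_mul_inv, norm_mul]

/-- A scaling whose moment map vanishes somewhere has fewer points in its generic moment fibres than
a generic scaling. -/
theorem ncard_lt_of_logMoment_eq_zero [Nonempty ι] {B : Matrix κ ι ℤ} {l : κ → ℤ}
    (hl : ∀ j, ∑ k, l k * B k j = 1) {D : ℕ} (hD : 0 < D) {f : MvPolynomial (ι ⊕ κ) ℂ} (hf : f ≠ 0)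
    (hfD : ∀ c w, MvPolynomial.eval (Sum.elim c w) f ≠ 0 →
        (momentFiber B c w).Finite ∧ (momentFiber B c w).ncard = D)
    {c : ι → ℂ} {z₀ : κ → ℂ} (h₀ : logMoment B c z₀ = 0)
    {N : ℕ} {g : MvPolynomial κ ℂ} (hg : g ≠ 0) (hgN : ∀ w, MvPolynomial.eval w g ≠ 0 →
      (momentFiber B c w).Finite ∧ (momentFiber B c w).ncard = N ∧
        ∀ z, logMoment B c z = w → LogMomentRegular B c z) : N < D := by
  obtain ⟨c₁, w, hfw, hgw⟩ : ∃ (c₁ : ι → ℂ) (w : κ → ℂ),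
      MvPolynomial.eval (Sum.elim c₁ w) f ≠ 0 ∧ MvPolynomial.eval w g ≠ 0 := by
    have hne : f * MvPolynomial.rename Sum.inr g ≠ 0 := mul_ne_zero hf fun h =>
      hg (MvPolynomial.rename_injective _ Sum.inr_injective (h.trans (map_zero _).symm))
    obtain ⟨x, hx⟩ : ∃ x, MvPolynomial.eval x (f * MvPolynomial.rename Sum.inr g) ≠ 0 := by
      by_contra! hx
      exact hne (MvPolynomial.funext fun x => (hx x).trans (map_zero _).symm)
    rw [map_mul, mul_ne_zero_iff, MvPolynomial.eval_rename] at hx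
    exact ⟨x ∘ Sum.inl, x ∘ Sum.inr, by rw [Sum.elim_comp_inl_inr]; exact hx.1, hx.2⟩
  obtain ⟨z₁, rfl⟩ : ∃ z₁, logMoment B c₁ z₁ = w := by
    obtain ⟨t, ht⟩ : (momentFiber B c₁ w).Nonempty :=
      Set.nonempty_of_ncard_ne_zero (by rw [(hfD c₁ w hfw).2]; exact hD.ne')
    obtain ⟨z₁, rfl⟩ := exists_exp_eq ht.1
    exact ⟨z₁, mem_momentFiber_exp.1 ht⟩
  set w := logMoment B c₁ z₁
  obtain ⟨γ, ζ, hγ, rfl, hγf, hζ, hbig⟩ := exists_degenerating_family hl h₀ f hfw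
  obtain ⟨hfin, hcard, hreg⟩ := hgN w hgw
  obtain ⟨U, hU, hdisj⟩ := hfin.t2_separation
  have j : ι := Classical.arbitrary ι
  have hlarge : ∀ᶠ ε in 𝓝[≠] (0 : ℂ), ∀ t ∈ momentFiber B (γ 0) w,
      ‖monomialMap B t j‖ + 1 < ‖Complex.exp (∑ k, (B k j : ℂ) * ζ ε k)‖ :=
    (eventually_all_finite hfin).2 fun t _ => (hbig j).eventually_gt_atTop _
  have hpersist : ∀ᶠ ε in 𝓝[≠] (0 : ℂ), ∀ t ∈ momentFiber B (γ 0) w,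
      ∃ t' ∈ momentFiber B (γ ε) w, t' ∈ U t ∧ ‖monomialMap B t' j‖ < ‖monomialMap B t j‖ + 1 := by
    refine (eventually_all_finite hfin).2 fun t ht => ?_
    obtain ⟨z, rfl⟩ := exists_exp_eq ht.1
    have hz := mem_momentFiber_exp.1 ht
    have hexp : Continuous fun z : κ → ℂ => fun k => Complex.exp (z k) := by fun_prop
    have hV1 : ∀ᶠ z' in 𝓝 z, (fun k => Complex.exp (z' k)) ∈ U fun k => Complex.exp (z k) :=
      hexp.continuousAt.eventually ((hU _).2.mem_nhds (hU _).1)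
    have hV2 : ∀ᶠ z' in 𝓝 z, ‖monomialMap B (fun k => Complex.exp (z' k)) j‖ <
        ‖monomialMap B (fun k => Complex.exp (z k)) j‖ + 1 := by
      simp only [monomialMap_exp]
      have hc : Continuous fun z' : κ → ℂ => ‖Complex.exp (∑ l, (B l j : ℂ) * z' l)‖ := by fun_prop
      exact hc.continuousAt.eventually (gt_mem_nhds (lt_add_one _))
    have h1 := (hγ.tendsto 0).eventually ((hreg z hz).eventually_exists (hV1.and hV2))
    refine (h1.filter_mono nhdsWithin_le_nhds).mono fun ε hε => ?_
    obtain ⟨z', ⟨hz'1, hz'2⟩, hz'⟩ := hε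
    exact ⟨_, mem_momentFiber_exp.2 (hz'.trans hz), hz'1, hz'2⟩
  obtain ⟨ε, hε1, hε2, hε3, hε4⟩ := (hγf.and (hζ.and (hlarge.and hpersist))).exists
  choose! s hs hsU hsj using hε4
  obtain ⟨hfin', hcard'⟩ := hfD _ _ hε1
  rw [← hcard, ← hcard']
  have hinj : Set.InjOn s (momentFiber B (γ 0) w) := by
    intro t ht t' ht' hss
    by_contra hne
    exact Set.disjoint_left.1 (hdisj ht ht' hne) (hsU t ht) (hss ▸ hsU t' ht')
  rw [← hinj.ncard_image]
  refine Set.ncard_lt_ncard ⟨Set.image_subset_iff.2 hs, fun hsub => ?_⟩ hfin'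
  obtain ⟨t, ht, hst⟩ := hsub (mem_momentFiber_exp.2 hε2)
  have h1 := (hsj t ht).trans (hε3 t ht)
  rw [hst, monomialMap_exp] at h1
  exact lt_irrefl _ h1

end Degeneration

section Substitution

variable {κ ι σ τ : Type} [Fintype κ] [Fintype ι]

theorem MvPolynomial.eval_aeval_eq_eval (p : τ → MvPolynomial σ ℂ) (x : σ → ℂ)
    (f : MvPolynomial τ ℂ) : eval x (aeval p f) = eval (fun i => eval x (p i)) f := by
  induction f using MvPolynomial.induction_on with
  | C a => simp
  | add f g hf hg => simp only [map_add, hf, hg]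
  | mul_X f i hf => simp only [map_mul, hf, aeval_X, eval_X]

/-- A substitution which is surjective on points is injective on polynomials. -/
theorem MvPolynomial.aeval_ne_zero_of_surjective {p : τ → MvPolynomial σ ℂ}
    (hp : ∀ y : τ → ℂ, ∃ x, (fun i => eval x (p i)) = y) {f : MvPolynomial τ ℂ} (hf : f ≠ 0) :
    aeval p f ≠ 0 := fun h => hf <| MvPolynomial.funext fun y => by
  obtain ⟨x, rfl⟩ := hp y
  rw [← eval_aeval_eq_eval, h, map_zero, map_zero]

theorem exists_sum_intCast_mul_eq [DecidableEq κ] {B : Matrix κ ι ℤ} {E : Matrix ι κ ℤ}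
    (hBE : B * E = 1) (w : κ → ℂ) :
    ∃ u : ι → ℂ, (fun k => ∑ j, (B k j : ℂ) * u j) = w := by
  have h : B.map (Int.cast : ℤ → ℂ) * E.map (Int.cast : ℤ → ℂ) = 1 := by
    have h := congrArg (fun M => M.map (Int.castRingHom ℂ)) hBE
    simp only [Matrix.map_mul, Matrix.map_one _ (map_zero _) (map_one _)] at h
    exact h
  refine ⟨(E.map (Int.cast : ℤ → ℂ)).mulVec w, ?_⟩
  change (B.map (Int.cast : ℤ → ℂ)).mulVec _ = w
  rw [Matrix.mulVec_mulVec, h, Matrix.one_mulVec]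

theorem MvPolynomial.sum_X_ne_zero {s : ι → σ} (hs : Function.Injective s) [Nonempty ι] :
    (∑ j, X (s j) : MvPolynomial σ ℂ) ≠ 0 := fun h => by
  classical
  have j : ι := Classical.arbitrary ι
  have := congrArg (eval (Pi.single (s j) 1)) h
  simp [Pi.single_apply, hs.eq_iff] at this

end Substitution

section SingularPoint

variable {κ ι μ : Type} [Fintype κ] [Fintype ι] [Fintype μ]

/-- A singular point of the Laurent polynomial with coefficients `c` gives a zero of the moment map
of `c`. -/
theorem exists_logMoment_eq_zero_of_singular [DecidableEq μ] {A : κ → ι → ℤ}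
    {B : Matrix μ ι ℤ} {E : Matrix ι μ ℤ} (hBE : B * E = 1)
    (hker : ∀ v : ι → ℤ, (∀ k, ∑ j, B k j * v j = 0) ↔
        (∀ i, ∑ j, A i j * v j = 0) ∧ ∑ j, v j = 0)
    (hkerC : ∀ x : ι → ℂ, (∀ k, ∑ j, (B k j : ℂ) * x j = 0) ↔
        (∀ i, ∑ j, (A i j : ℂ) * x j = 0) ∧ ∑ j, x j = 0)
    {c : ι → ℂ} {θ : κ → ℂ} (hθ : ∀ i, θ i ≠ 0) (h0 : ∑ j, c j * ∏ i, θ i ^ A i j = 0)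
    (h1 : ∀ i, ∑ j, (A i j : ℂ) * c j * ∏ i', θ i' ^ A i' j = 0) :
    ∃ z, logMoment B c z = 0 := by
  classical
  let q : ι → ℂ := monomialMap (Matrix.of A) θ
  have hq0 : ∀ j, q j ≠ 0 := monomialMap_ne_zero _ hθ
  have hq : monomialMap B (monomialMap E q) = q :=
    monomialMap_eq_self_of_prod_zpow_eq_one hBE hq0 fun v hv => by
      rw [prod_zpow_zpow_eq hθ]
      exact Finset.prod_eq_one fun i _ => by
        simp only [Matrix.of_apply, ((hker v).1 hv).1 i, zpow_zero]
  obtain ⟨z, hz⟩ := exists_exp_eq (monomialMap_ne_zero E hq0)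
  refine ⟨z, mem_momentFiber_exp.1 ?_⟩
  rw [hz]
  refine ⟨monomialMap_ne_zero E hq0, ?_⟩
  rw [hq]
  refine (hkerC fun j => c j * q j).2 ⟨fun i => ?_, h0⟩
  simp only [← mul_assoc]
  exact h1 i

end SingularPoint

/-- For a generic pair `(c,u)` the likelihood system has exactly `D` solutions
(the ML degree of the generic scaling equals `deg V`), and for every scaling `c`
lying on the principal `A`-determinant locus — i.e. such that the Laurent polynomial
`f = ∑ c j θ^{a_j}` has a singular point in the torus — the generic number of
solutions `N` is strictly smaller than `D`. -/
theorem ml_degree_drops_iff_principal_A_determinant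
    (r n : ℕ) (hr : 0 < r) (hn : 0 < n) (A : Fin r → Fin n → ℤ) :
    ∃ (D : ℕ) (H : MvPolynomial (Fin n ⊕ Fin n) ℂ), H ≠ 0 ∧
      (∀ c u : Fin n → ℂ, (∀ j, c j ≠ 0) →
        MvPolynomial.eval (Sum.elim c u) H ≠ 0 →
        (mlSolutions A c u).Finite ∧ (mlSolutions A c u).ncard = D) ∧
      (∀ c : Fin n → ℂ, (∀ j, c j ≠ 0) →
        (∃ θ : Fin r → ℂ, (∀ i, θ i ≠ 0) ∧
          (∑ j, c j * ∏ i, θ i ^ (A i j)) = 0 ∧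
          (∀ i, (∑ j, (A i j : ℂ) * c j * ∏ i', θ i' ^ (A i' j)) = 0)) →
        ∃ (N : ℕ) (G : MvPolynomial (Fin n) ℂ), N < D ∧ G ≠ 0 ∧
          ∀ u : Fin n → ℂ, MvPolynomial.eval u G ≠ 0 →
            (mlSolutions A c u).Finite ∧ (mlSolutions A c u).ncard = N) := by
  have : Nonempty (Fin n) := ⟨⟨0, hn⟩⟩
  obtain ⟨m, B, E, l, hBE, hl, hker, hkerC⟩ := exists_lattice_coordinates A
  obtain ⟨D, f, hD, hf, hfD⟩ := exists_ncard_momentFiber_of_scaling hBE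
  have htransfer : ∀ (c u : Fin n → ℂ) (N : ℕ), ∑ j, u j ≠ 0 →
      (momentFiber B c fun k => ∑ j, (B k j : ℂ) * u j).Finite →
      (momentFiber B c fun k => ∑ j, (B k j : ℂ) * u j).ncard = N →
      (mlSolutions A c u).Finite ∧ (mlSolutions A c u).ncard = N := by
    intro c u N hu hfin hcard
    have hbij := bijOn_momentFiber_mlSolutions hBE hker hkerC c u hu
    rw [← hbij.image_eq, hbij.injOn.ncard_image]
    exact ⟨hfin.image _, hcard⟩
  let b : Fin m → MvPolynomial (Fin n) ℂ := fun k =>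
    ∑ j, MvPolynomial.C (B k j : ℂ) * MvPolynomial.X j
  have hb : ∀ u : Fin n → ℂ,
      (fun k => MvPolynomial.eval u (b k)) = fun k => ∑ j, (B k j : ℂ) * u j := fun u => by
    simp [b]
  let p : Fin n ⊕ Fin m → MvPolynomial (Fin n ⊕ Fin n) ℂ :=
    Sum.elim (fun j => MvPolynomial.X (Sum.inl j)) fun k => MvPolynomial.rename Sum.inr (b k)
  have hp : ∀ c u : Fin n → ℂ, (fun i => MvPolynomial.eval (Sum.elim c u) (p i)) =
      Sum.elim c fun k => ∑ j, (B k j : ℂ) * u j := by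
    intro c u
    funext i
    rcases i with j | k
    · simp [p]
    · simp only [p, Sum.elim_inr, MvPolynomial.eval_rename, Sum.elim_comp_inr]
      exact congrFun (hb u) k
  refine ⟨D, (∑ j, MvPolynomial.X (Sum.inr j)) * MvPolynomial.aeval p f, ?_, ?_, ?_⟩
  · refine mul_ne_zero (MvPolynomial.sum_X_ne_zero Sum.inr_injective)
      (MvPolynomial.aeval_ne_zero_of_surjective (fun y => ?_) hf)
    obtain ⟨u, hu⟩ := exists_sum_intCast_mul_eq hBE (y ∘ Sum.inr)
    exact ⟨Sum.elim (y ∘ Sum.inl) u, by rw [hp, hu, Sum.elim_comp_inl_inr]⟩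
  · intro c u _ hH
    rw [map_mul, mul_ne_zero_iff, MvPolynomial.eval_aeval_eq_eval, hp] at hH
    obtain ⟨hfin, hcard⟩ := hfD _ _ hH.2
    exact htransfer c u D (by simpa using hH.1) hfin hcard
  · rintro c - ⟨θ, hθ, h0, h1⟩
    obtain ⟨z₀, hz₀⟩ := exists_logMoment_eq_zero_of_singular hBE hker hkerC hθ h0 h1
    obtain ⟨N, g, hg, hgN⟩ := exists_ncard_momentFiber B c
    refine ⟨N, (∑ j, MvPolynomial.X j) * MvPolynomial.aeval b g,
      ncard_lt_of_logMoment_eq_zero hl hD hf hfD hz₀ hg hgN, ?_, fun u hG => ?_⟩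
    · refine mul_ne_zero (MvPolynomial.sum_X_ne_zero Function.injective_id)
        (MvPolynomial.aeval_ne_zero_of_surjective (fun y => ?_) hg)
      obtain ⟨u, hu⟩ := exists_sum_intCast_mul_eq hBE y
      exact ⟨u, by rw [hb, hu]⟩
    · rw [map_mul, mul_ne_zero_iff, MvPolynomial.eval_aeval_eq_eval, hb] at hG
      obtain ⟨hfin, hcard, -⟩ := hgN _ hG.2
      exact htransfer c u N (by simpa using hG.1) hfin hcard
end

section
/- With A a (d−1)×(d+1) integer matrix of rank d−1 in general position and w a primitive generator of the kernel lattice of A′ as in the context (so every w_i ≠ 0 and Σ_i w_i = 0, and the toric variety V is the hypersurface of degree δ = Σ_{w_i>0} w_i defined by ∏_{w_i>0} p_i^{w_i} − ∏_{w_i<0} p_i^{−w_i}): for every c ∈ (ℂ*)^{d+1} there exist a natural number N and a nonzero polynomial G ∈ ℂ[u_1,…,u_{d+1}] such that for every u ∈ ℂ^{d+1} with G(u) ≠ 0 the likelihood system for (A,c,u) has exactly N solutions, and N < δ if and only if (∏_{w_i<0} w_i^{−w_i})·∏_{w_i>0} c_i^{w_i} = (∏_{w_i>0} w_i^{w_i})·∏_{w_i<0}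 c_i^{−w_i}. -/
open scoped BigOperators

open Polynomial in
/-- For `F` a polynomial with coefficients in a multivariate polynomial ring, separability of the
specializations of a given degree is an open condition. -/
theorem Polynomial.exists_eval_ne_zero_imp_separable {σ K : Type*} [Field K] [CharZero K]
    (F : (MvPolynomial σ K)[X]) (u₀ : σ → K)
    (hF₀ : F.map (MvPolynomial.eval u₀) ≠ 0)
    (hsep : (F.map (MvPolynomial.eval u₀)).Separable) :
    ∃ D : MvPolynomial σ K, MvPolynomial.eval u₀ D ≠ 0 ∧
      ∀ u, F.map (MvPolynomial.eval u) ≠ 0 →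
        (F.map (MvPolynomial.eval u)).natDegree = (F.map (MvPolynomial.eval u₀)).natDegree →
        MvPolynomial.eval u D ≠ 0 → (F.map (MvPolynomial.eval u)).Separable := by
  set N := (F.map (MvPolynomial.eval u₀)).natDegree with hN
  have key : ∀ u, F.map (MvPolynomial.eval u) ≠ 0 →
      (F.map (MvPolynomial.eval u)).natDegree = N →
      (MvPolynomial.eval u (resultant F (derivative F) N (N - 1)) ≠ 0 ↔
        (F.map (MvPolynomial.eval u)).Separable) := by
    intro u hu hdeg
    have h := resultant_eq_zero_iff (f := F.map (MvPolynomial.eval u))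
      (g := derivative (F.map (MvPolynomial.eval u)))
    rw [natDegree_derivative, hdeg, derivative_map, resultant_map_map] at h
    rw [Ne, h, separable_def, derivative_map]
    simp [hu]
  exact ⟨_, (key u₀ hF₀ rfl).2 hsep, fun u hu hdeg hD => (key u hu hdeg).1 hD⟩

/-- A complex vector in the kernel of an integer matrix whose integer kernel is spanned by `w` is
a multiple of `w`. The row of ones is kept separate from the rows of `A`. -/
theorem exists_eq_mul_of_int_kernel {κ ι : Type*} [Fintype ι] [Nonempty ι]
    {A : κ → ι → ℤ} {w : ι → ℤ} (hw0 : ∀ i, w i ≠ 0)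
    (hker : ∀ v : ι → ℤ, (∀ i, ∑ j, A i j * v j = 0) → (∑ j, v j = 0) → ∃ t : ℤ, v = t • w)
    (z : ι → ℂ) (hz : ∀ i, ∑ j, (A i j : ℂ) * z j = 0) (hzsum : ∑ j, z j = 0) :
    ∃ t : ℂ, ∀ j, z j = w j * t := by
  have rational : ∀ r : ι → ℚ, (∀ i, ∑ j, (A i j : ℚ) * r j = 0) → (∑ j, r j = 0) →
      ∀ j k, r j * w k = r k * w j := by
    intro r hr hrsum j k
    obtain ⟨b, hb⟩ := IsLocalization.exist_integer_multiples_of_finite (nonZeroDivisors ℤ) r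
    choose v hv using hb
    have hb0 : ((b : ℤ) : ℚ) ≠ 0 := by exact_mod_cast nonZeroDivisors.coe_ne_zero b
    have hv' : ∀ i, (v i : ℚ) = b * r i := fun i => by simpa using hv i
    obtain ⟨t, rfl⟩ := hker v
      (fun i => by
        have : ((∑ j, A i j * v j : ℤ) : ℚ) = 0 := by
          push_cast
          simp_rw [hv', mul_left_comm _ ((b : ℤ) : ℚ), ← Finset.mul_sum, hr, mul_zero]
        exact_mod_cast this)
      (by
        have : ((∑ j, v j : ℤ) : ℚ) = 0 := by
          push_cast
          simp_rw [hv', ← Finset.mul_sum, hrsum, mul_zero]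
        exact_mod_cast this)
    have hj := hv' j
    have hk := hv' k
    simp only [Pi.smul_apply, smul_eq_mul, Int.cast_mul] at hj hk
    apply mul_left_cancel₀ hb0
    linear_combination (w j : ℚ) * hk - (w k : ℚ) * hj
  have cross : ∀ j k, z j * w k = z k * w j := by
    intro j k
    let B := Module.Basis.ofVectorSpace ℚ ℂ
    have smul_eq : ∀ (m : ℤ) (x : ℂ), (m : ℂ) * x = (m : ℚ) • x := fun m x => by
      rw [Rat.smul_def]; simp
    apply B.ext_elem
    intro i
    have h := rational (fun j => B.repr (z j) i)
      (fun l => by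
        have := congrArg (fun x => B.repr x i) (hz l)
        simpa [smul_eq, map_sum, Finsupp.finsetSum_apply] using this)
      (by
        have := congrArg (fun x => B.repr x i) hzsum
        simpa [map_sum, Finsupp.finsetSum_apply] using this) j k
    rw [mul_comm (z j), mul_comm (z k), smul_eq, smul_eq]
    simpa [mul_comm] using h
  obtain ⟨k⟩ := ‹Nonempty ι›
  have hk : (w k : ℂ) ≠ 0 := by exact_mod_cast hw0 k
  refine ⟨z k / w k, fun j => ?_⟩
  field_simp
  linear_combination cross j k

/-- Positive and negative parts of an integer vector with sum zero have the same total. -/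
theorem sum_toNat_neg_eq {ι : Type*} [Fintype ι] {w : ι → ℤ} (hwsum : ∑ j, w j = 0) :
    ∑ j, (-w j).toNat = ∑ j, (w j).toNat := by
  have h : ∑ j, (((w j).toNat : ℤ) - (-w j).toNat) = 0 := by
    simpa only [Int.toNat_sub_toNat_neg] using hwsum
  rw [Finset.sum_sub_distrib, sub_eq_zero] at h
  exact_mod_cast h.symm

/-- The binomial relations for all multiples of `w` follow from the one for `w`. -/
theorem forall_binomial_iff {κ ι M : Type*} [Fintype ι] [CommMonoid M]
    {A : κ → ι → ℤ} {w : ι → ℤ}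
    (hwA : ∀ i, ∑ j, A i j * w j = 0) (hwsum : ∑ j, w j = 0)
    (hker : ∀ v : ι → ℤ, (∀ i, ∑ j, A i j * v j = 0) → (∑ j, v j = 0) → ∃ t : ℤ, v = t • w)
    (p : ι → M) :
    (∀ v : ι → ℤ, (∀ i, ∑ j, A i j * v j = 0) → (∑ j, v j = 0) →
      (∏ j, p j ^ (max (v j) 0).toNat) = (∏ j, p j ^ (max (-v j) 0).toNat)) ↔
    ∏ j, p j ^ (w j).toNat = ∏ j, p j ^ (-w j).toNat := by
  have hmax : ∀ m : ℤ, (max m 0).toNat = m.toNat := fun m => by omega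
  simp only [hmax]
  refine ⟨fun h => h w hwA hwsum, fun h v hv hvsum => ?_⟩
  obtain ⟨t, rfl⟩ := hker v hv hvsum
  have hmul : ∀ (n : ℕ) (m : ℤ), ((n : ℤ) * m).toNat = m.toNat * n := fun n m => by
    obtain ⟨k, rfl | rfl⟩ := m.eq_nat_or_neg
    · rw [← Nat.cast_mul, Int.toNat_natCast, Int.toNat_natCast, mul_comm]
    · rw [mul_neg, ← Nat.cast_mul, Int.toNat_neg_natCast, Int.toNat_neg_natCast, zero_mul]
  obtain ⟨n, rfl | rfl⟩ := t.eq_nat_or_neg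
  · simp only [Pi.smul_apply, smul_eq_mul, ← mul_neg, hmul, pow_mul, Finset.prod_pow, h]
  · simp only [Pi.smul_apply, smul_eq_mul, neg_mul, neg_neg]
    simp only [← mul_neg, hmul, pow_mul, Finset.prod_pow, h]

namespace LikelihoodFiber

open Polynomial

variable {ι : Type*} [Fintype ι]

/-- The restriction of the binomial `a * ∏ q_j ^ w_j⁺ - b * ∏ q_j ^ w_j⁻` to the line
`q = u + s * w`, as a polynomial in `s`. -/
noncomputable def fiberPoly {R : Type*} [CommRing R] (w : ι → ℤ) (a b : R) (u : ι → R) : R[X] :=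
  C a * ∏ j, (C (u j) + C (w j : R) * X) ^ (w j).toNat -
    C b * ∏ j, (C (u j) + C (w j : R) * X) ^ (-w j).toNat

theorem map_fiberPoly {R S : Type*} [CommRing R] [CommRing S] (f : R →+* S) (w : ι → ℤ)
    (a b : R) (u : ι → R) :
    (fiberPoly w a b u).map f = fiberPoly w (f a) (f b) (fun j => f (u j)) := by
  simp [fiberPoly, Polynomial.map_prod]

variable {K : Type*} [Field K]

theorem prod_linear_pow_eq {s : ι → K} (hs : ∀ j, s j ≠ 0) (u : ι → K) (e : ι → ℕ) :
    ∏ j, (C (u j) + C (s j) * X) ^ e j =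
      C (∏ j, s j ^ e j) * ∏ j, (X - C (-(u j / s j))) ^ e j := by
  rw [map_prod, ← Finset.prod_mul_distrib]
  refine Finset.prod_congr rfl fun j _ => ?_
  rw [C_pow, ← mul_pow, mul_sub, ← C_mul, mul_neg, mul_div_cancel₀ _ (hs j), C_neg, sub_neg_eq_add,
    add_comm]

theorem monic_prod_X_sub_C_pow (y : ι → K) (e : ι → ℕ) :
    (∏ j, (X - C (y j)) ^ e j).Monic :=
  monic_prod_of_monic _ _ fun _ _ => (monic_X_sub_C _).pow _

theorem natDegree_prod_X_sub_C_pow (y : ι → K) (e : ι → ℕ) :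
    (∏ j, (X - C (y j)) ^ e j).natDegree = ∑ j, e j := by
  rw [natDegree_prod_of_monic _ _ fun _ _ => (monic_X_sub_C _).pow _]
  simp

theorem nextCoeff_prod_X_sub_C_pow (y : ι → K) (e : ι → ℕ) :
    (∏ j, (X - C (y j)) ^ e j).nextCoeff = -∑ j, e j * y j := by
  rw [Monic.nextCoeff_prod _ _ fun j _ => (monic_X_sub_C _).pow _]
  simp [(monic_X_sub_C _).nextCoeff_pow]

variable [CharZero K] {w : ι → ℤ} (hw0 : ∀ i, w i ≠ 0) (hwsum : ∑ j, w j = 0)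

include hw0 in
theorem fiberPoly_eq (a b : K) (u : ι → K) :
    fiberPoly w a b u =
      C (a * ∏ j, (w j : K) ^ (w j).toNat) * ∏ j, (X - C (-(u j / w j))) ^ (w j).toNat -
      C (b * ∏ j, (w j : K) ^ (-w j).toNat) * ∏ j, (X - C (-(u j / w j))) ^ (-w j).toNat := by
  have hs : ∀ j, (w j : K) ≠ 0 := fun j => by exact_mod_cast hw0 j
  rw [fiberPoly, prod_linear_pow_eq hs, prod_linear_pow_eq hs, C_mul, C_mul, mul_assoc, mul_assoc]

include hw0 in
theorem sum_toNat_pos [Nonempty ι] (hwsum : ∑ j, w j = 0) : 0 < ∑ j, (w j).toNat := by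
  rw [pos_iff_ne_zero]
  intro h
  have hneg := sum_toNat_neg_eq hwsum ▸ h
  obtain ⟨k⟩ := ‹Nonempty ι›
  have h1 := Finset.sum_eq_zero_iff.1 h k (Finset.mem_univ k)
  have h2 := Finset.sum_eq_zero_iff.1 hneg k (Finset.mem_univ k)
  have := hw0 k
  omega

open Classical in
include hw0 hwsum in
theorem natDegree_fiberPoly [Nonempty ι] {a b : K} (ha : a ≠ 0) {u : ι → K}
    (hu : ∑ j, u j ≠ 0) :
    fiberPoly w a b u ≠ 0 ∧ (fiberPoly w a b u).natDegree =
      if a * ∏ j, (w j : K) ^ (w j).toNat = b * ∏ j, (w j : K) ^ (-w j).toNat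
      then ∑ j, (w j).toNat - 1 else ∑ j, (w j).toNat := by
  have hs : ∀ j, (w j : K) ≠ 0 := fun j => by exact_mod_cast hw0 j
  have hδ := sum_toNat_pos hw0 hwsum
  have hα : a * ∏ j, (w j : K) ^ (w j).toNat ≠ 0 :=
    mul_ne_zero ha (Finset.prod_ne_zero_iff.2 fun j _ => pow_ne_zero _ (hs j))
  rw [fiberPoly_eq hw0]
  set α := a * ∏ j, (w j : K) ^ (w j).toNat
  set β := b * ∏ j, (w j : K) ^ (-w j).toNat
  set y : ι → K := fun j => -(u j / w j) with hy
  have hP := monic_prod_X_sub_C_pow y fun j => (w j).toNat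
  have hQ := monic_prod_X_sub_C_pow y fun j => (-w j).toNat
  have hPd := natDegree_prod_X_sub_C_pow y fun j => (w j).toNat
  have hQd := natDegree_prod_X_sub_C_pow y fun j => (-w j).toNat
  have hPn := nextCoeff_prod_X_sub_C_pow y fun j => (w j).toNat
  have hQn := nextCoeff_prod_X_sub_C_pow y fun j => (-w j).toNat
  rw [sum_toNat_neg_eq hwsum] at hQd
  set P := ∏ j, (X - C (y j)) ^ (w j).toNat
  set Q := ∏ j, (X - C (y j)) ^ (-w j).toNat
  set δ := ∑ j, (w j).toNat
  have hPc : P.coeff δ = 1 := by rw [← hPd]; exact hP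
  have hQc : Q.coeff δ = 1 := by rw [← hQd]; exact hQ
  have hle : (C α * P - C β * Q).natDegree ≤ δ :=
    (natDegree_sub_le_of_le ((natDegree_C_mul_le _ _).trans hPd.le)
      ((natDegree_C_mul_le _ _).trans hQd.le)).trans (max_self _).le
  have hcoeff : (C α * P - C β * Q).coeff δ = α - β := by simp [hPc, hQc]
  suffices h : ∃ n, (C α * P - C β * Q).coeff n ≠ 0 ∧ (C α * P - C β * Q).natDegree ≤ n ∧
      n = if α = β then δ - 1 else δ by
    obtain ⟨n, hn0, hn, rfl⟩ := h
    exact ⟨fun h => hn0 (by rw [h, coeff_zero]), natDegree_eq_of_le_of_coeff_ne_zero hn hn0⟩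
  split_ifs with hαβ
  · refine ⟨δ - 1, ?_, natDegree_le_pred hle (by rw [hcoeff, hαβ, sub_self]), rfl⟩
    have hsum : P.nextCoeff - Q.nextCoeff = ∑ j, u j := by
      rw [hPn, hQn, neg_sub_neg, ← Finset.sum_sub_distrib]
      refine Finset.sum_congr rfl fun j _ => ?_
      have hpm : (((w j).toNat : K)) - ((-w j).toNat : K) = w j := by
        exact_mod_cast congrArg (Int.cast : ℤ → K) (Int.toNat_sub_toNat_neg (w j))
      have := hs j
      simp only [hy]
      rw [← sub_mul, ← neg_sub, hpm]
      field_simp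
    rw [nextCoeff_of_natDegree_pos (hPd ▸ hδ), nextCoeff_of_natDegree_pos (hQd ▸ hδ), hPd,
      hQd] at hsum
    rw [← hαβ, coeff_sub, coeff_C_mul, coeff_C_mul, ← mul_sub, hsum]
    exact mul_ne_zero hα hu
  · exact ⟨δ, by rwa [hcoeff, sub_ne_zero], hle, rfl⟩

theorem separable_C_mul_X_pow_sub {α β : K} (hα : α ≠ 0) (hβ : β ≠ 0) {n : ℕ} (hn : n ≠ 0) :
    (C α * X ^ n - C β * (X - 1) ^ n : K[X]).Separable := by
  obtain ⟨k, rfl⟩ := Nat.exists_eq_succ_of_ne_zero hn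
  have hcop : IsCoprime (C ((k + 1 : K) * β) * (X - 1) ^ k : K[X])
      (C ((k + 1 : K) * α) * X ^ k) := by
    have hk : (k + 1 : K) ≠ 0 := by exact_mod_cast k.succ_ne_zero
    rw [isCoprime_mul_unit_left_left (isUnit_C.2 (mul_ne_zero hk hβ).isUnit),
      isCoprime_mul_unit_left_right (isUnit_C.2 (mul_ne_zero hk hα).isUnit)]
    exact IsCoprime.pow ⟨-1, 1, by ring⟩
  obtain ⟨r, s, h⟩ := hcop
  have hder : derivative (C α * X ^ (k + 1) - C β * (X - 1) ^ (k + 1) : K[X]) =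
      (k + 1 : K[X]) * (C α * X ^ k - C β * (X - 1) ^ k) := by
    simp [derivative_pow]
    ring
  refine ⟨(r + s) * (k + 1 : K[X]), -(r * X + s * (X - 1)), ?_⟩
  rw [Nat.succ_eq_add_one, hder]
  simp only [C_mul, C_add, map_natCast, C_1] at h
  linear_combination h

include hw0 hwsum in
/-- There is a data vector for which the positive and the negative factors of the binomial each
coalesce, so that the fibre polynomial is a difference of two powers and hence separable. -/
theorem exists_separable_fiberPoly [Nonempty ι] {a b : K} (ha : a ≠ 0) (hb : b ≠ 0) :
    ∃ u : ι → K, ∑ j, u j ≠ 0 ∧ (fiberPoly w a b u).Separable := by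
  have hs : ∀ j, (w j : K) ≠ 0 := fun j => by exact_mod_cast hw0 j
  have hδ := sum_toNat_pos hw0 hwsum
  have hprod : ∀ e : ι → ℕ, ∏ j, (w j : K) ^ e j ≠ 0 := fun e =>
    Finset.prod_ne_zero_iff.2 fun j _ => pow_ne_zero _ (hs j)
  refine ⟨fun j => ((-w j).toNat : K), ?_, ?_⟩
  · rw [← Nat.cast_sum, sum_toNat_neg_eq hwsum]
    exact_mod_cast hδ.ne'
  · have hP : ∏ j, (X - C (-(((-w j).toNat : K) / w j))) ^ (w j).toNat =
        (X : K[X]) ^ ∑ j, (w j).toNat := by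
      rw [← Finset.prod_pow_eq_pow_sum]
      refine Finset.prod_congr rfl fun j _ => ?_
      rcases le_total (w j) 0 with h | h
      · simp [Int.toNat_of_nonpos h]
      · rw [Int.toNat_of_nonpos (neg_nonpos.2 h)]; simp
    have hQ : ∏ j, (X - C (-(((-w j).toNat : K) / w j))) ^ (-w j).toNat =
        (X - 1 : K[X]) ^ ∑ j, (w j).toNat := by
      rw [← sum_toNat_neg_eq hwsum, ← Finset.prod_pow_eq_pow_sum]
      refine Finset.prod_congr rfl fun j _ => ?_
      rcases le_total (w j) 0 with h | h
      · have hc : ((-w j).toNat : K) = -w j := by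
          exact_mod_cast congrArg (Int.cast : ℤ → K) (Int.toNat_of_nonneg (neg_nonneg.2 h))
        rw [hc, neg_div, neg_neg, div_self (hs j), C_1]
      · rw [Int.toNat_of_nonpos (neg_nonpos.2 h)]; simp
    rw [fiberPoly_eq hw0, hP, hQ]
    exact separable_C_mul_X_pow_sub (mul_ne_zero ha (hprod _)) (mul_ne_zero hb (hprod _)) hδ.ne'

omit [CharZero K] in
theorem eval_fiberPoly (a b : K) (u : ι → K) (s : K) :
    (fiberPoly w a b u).eval s =
      a * ∏ j, (u j + w j * s) ^ (w j).toNat - b * ∏ j, (u j + w j * s) ^ (-w j).toNat := by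
  simp [fiberPoly, eval_prod]

omit [CharZero K] in
/-- The coordinates stay nonzero at the zeros of the fibre polynomial as long as no two of the
linear factors have a common zero. -/
theorem ne_zero_of_eval_fiberPoly_eq_zero {a b : K} (ha : a ≠ 0) (hb : b ≠ 0)
    (hw0 : ∀ i, w i ≠ 0) {u : ι → K}
    (hu : ∀ i j, i ≠ j → u i * w j - u j * w i ≠ 0) {s : K}
    (hroot : (fiberPoly w a b u).eval s = 0) (i : ι) : u i + w i * s ≠ 0 := by
  intro hi
  rw [eval_fiberPoly, sub_eq_zero] at hroot
  suffices h : ∃ j, i ≠ j ∧ u j + w j * s = 0 by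
    obtain ⟨j, hij, hj⟩ := h
    exact hu i j hij (by linear_combination (w j : K) * hi - (w i : K) * hj)
  have zero_of : ∀ e : ι → ℕ, e i ≠ 0 → ∏ j, (u j + w j * s) ^ e j = 0 := fun e he =>
    Finset.prod_eq_zero (Finset.mem_univ i) (by rw [hi, zero_pow he])
  have exists_of : ∀ e : ι → ℕ, e i = 0 → ∏ j, (u j + w j * s) ^ e j = 0 →
      ∃ j, i ≠ j ∧ u j + w j * s = 0 := fun e he h => by
    obtain ⟨j, -, hj⟩ := Finset.prod_eq_zero_iff.1 h
    rw [pow_eq_zero_iff'] at hj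
    exact ⟨j, fun hij => hj.2 (hij ▸ he), hj.1⟩
  rcases lt_or_gt_of_ne (hw0 i) with h | h
  · refine exists_of (fun j => (w j).toNat) (by simp; omega) ?_
    rw [zero_of (fun j => (-w j).toNat) (by simp; omega), mul_zero] at hroot
    exact (mul_eq_zero.1 hroot).resolve_left ha
  · refine exists_of (fun j => (-w j).toNat) (by simp; omega) ?_
    rw [zero_of (fun j => (w j).toNat) (by simp; omega), mul_zero] at hroot
    exact (mul_eq_zero.1 hroot.symm).resolve_left hb

include hwsum in
omit [CharZero K] in
/-- On the line through `u / u₊` the binomial for `w` is the fibre polynomial. -/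
theorem eval_fiberPoly_eq_zero_iff {c : ι → K} (hc : ∀ j, c j ≠ 0) {u p : ι → K} {r s : K}
    (hr : r ≠ 0) (hp : ∀ j, u j + w j * s = r * (c j * p j)) :
    (fiberPoly w (∏ j, c j ^ (-w j).toNat) (∏ j, c j ^ (w j).toNat) u).eval s = 0 ↔
      ∏ j, p j ^ (w j).toNat = ∏ j, p j ^ (-w j).toNat := by
  have hprod : ∀ e : ι → ℕ, ∏ j, c j ^ e j ≠ 0 := fun e =>
    Finset.prod_ne_zero_iff.2 fun j _ => pow_ne_zero _ (hc j)
  rw [eval_fiberPoly]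
  simp only [hp, mul_pow, Finset.prod_mul_distrib, Finset.prod_pow_eq_pow_sum,
    sum_toNat_neg_eq hwsum]
  have h := mul_ne_zero (mul_ne_zero (hprod fun j => (w j).toNat) (hprod fun j => (-w j).toNat))
    (pow_ne_zero (∑ j, (w j).toNat) hr)
  rw [← sub_eq_zero (a := ∏ j, p j ^ (w j).toNat)]
  refine Iff.trans ?_ (mul_eq_zero_iff_left h)
  constructor <;> intro h' <;> linear_combination h'

/-- For generic data the solutions of the likelihood system are parametrized by the zeros of the
fibre polynomial. -/
theorem mlSolutions_eq_image {κ : Type*} [Fintype κ] [Nonempty ι] {A : κ → ι → ℤ}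
    (hw0 : ∀ i, w i ≠ 0) (hwA : ∀ i, ∑ j, A i j * w j = 0) (hwsum : ∑ j, w j = 0)
    (hker : ∀ v : ι → ℤ, (∀ i, ∑ j, A i j * v j = 0) → (∑ j, v j = 0) → ∃ t : ℤ, v = t • w)
    {c u : ι → ℂ} (hc : ∀ j, c j ≠ 0) (husum : ∑ j, u j ≠ 0)
    (hu : ∀ i j, i ≠ j → u i * w j - u j * w i ≠ 0) :
    mlSolutions A c u = (fun s j => (u j + w j * s) / ((∑ k, u k) * c j)) ''
      {s | (fiberPoly w (∏ j, c j ^ (-w j).toNat) (∏ j, c j ^ (w j).toNat) u).eval s = 0} := by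
  have hprod : ∀ e : ι → ℕ, ∏ j, c j ^ e j ≠ 0 := fun e =>
    Finset.prod_ne_zero_iff.2 fun j _ => pow_ne_zero _ (hc j)
  ext p
  simp only [mlSolutions, Set.mem_image, Set.mem_ofPred_eq, forall_binomial_iff hwA hwsum hker]
  constructor
  · rintro ⟨-, hbin, hsum, hA⟩
    obtain ⟨s, hs⟩ := exists_eq_mul_of_int_kernel hw0 hker
      (fun j => (∑ k, u k) * (c j * p j) - u j)
      (fun i => by
        simp only [mul_sub, Finset.sum_sub_distrib, mul_left_comm _ (∑ k, u k),
          ← Finset.mul_sum, hA, sub_self])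
      (by rw [Finset.sum_sub_distrib, ← Finset.mul_sum, hsum, mul_one, sub_self])
    have hs' : ∀ j, u j + w j * s = (∑ k, u k) * (c j * p j) := fun j => by
      linear_combination -hs j
    refine ⟨s, (eval_fiberPoly_eq_zero_iff hwsum hc husum hs').2 hbin, ?_⟩
    funext j
    have := hc j
    rw [hs']
    field_simp
  · rintro ⟨s, hroot, rfl⟩
    have hs : ∀ j, u j + w j * s =
        (∑ k, u k) * (c j * ((u j + w j * s) / ((∑ k, u k) * c j))) := fun j => by
      have := hc j
      field_simp
    have hs' : ∀ j, c j * ((u j + w j * s) / ((∑ k, u k) * c j)) =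
        (u j + w j * s) / ∑ k, u k := fun j => by
      have := hc j
      field_simp
    refine ⟨fun j => div_ne_zero
        (ne_zero_of_eval_fiberPoly_eq_zero (hprod _) (hprod _) hw0 hu hroot j)
        (mul_ne_zero husum (hc j)),
      (eval_fiberPoly_eq_zero_iff hwsum hc husum hs).1 hroot, ?_, fun i => ?_⟩
    · have hwC : ∑ j, (w j : ℂ) = 0 := by exact_mod_cast hwsum
      simp only [hs', ← Finset.sum_div, Finset.sum_add_distrib, ← Finset.sum_mul, hwC]
      field_simp
      simp
    · have hwC : ∑ j, (A i j : ℂ) * w j = 0 := by exact_mod_cast hwA i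
      simp only [hs', mul_div_assoc', ← Finset.sum_div]
      rw [mul_div_cancel_left₀ _ husum]
      simp only [mul_add, ← mul_assoc, Finset.sum_add_distrib, ← Finset.sum_mul, hwC]
      simp

end LikelihoodFiber

/-- Toric hypersurfaces in general position: `A` is a `(d-1) × (d+1)` integer matrix and
`w` is a primitive generator, with full support, of the kernel lattice of the row-augmented
matrix `A'`.  The toric variety `V` is the hypersurface of degree `δ = ∑_{w i > 0} w i`
cut out by `∏_{w i>0} p i ^ (w i) - ∏_{w i<0} p i ^ (-w i)`.  For every scaling `c` the
generic number `N` of solutions of the likelihood system (the ML degree of `V^c`)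
satisfies `N < δ` iff `c` lies on the `A`-discriminant
`(∏_{w i<0} w i ^ (-w i)) ∏_{w i>0} c i ^ (w i) = (∏_{w i>0} w i ^ (w i)) ∏_{w i<0} c i ^ (-w i)`. -/
theorem ml_degree_toric_hypersurface
    (d : ℕ) (hd : 2 ≤ d) (A : Fin (d - 1) → Fin (d + 1) → ℤ)
    (w : Fin (d + 1) → ℤ)
    (hw0 : ∀ i, w i ≠ 0)
    (hwA : ∀ i, ∑ j, A i j * w j = 0)
    (hwsum : ∑ j, w j = 0)
    (hgcd : Finset.univ.gcd w = 1)
    (hker : ∀ v : Fin (d + 1) → ℤ, (∀ i, ∑ j, A i j * v j = 0) → (∑ j, v j = 0) →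
      ∃ t : ℤ, v = t • w) :
    ∀ c : Fin (d + 1) → ℂ, (∀ j, c j ≠ 0) →
      ∃ (N : ℕ) (G : MvPolynomial (Fin (d + 1)) ℂ), G ≠ 0 ∧
        (∀ u : Fin (d + 1) → ℂ, MvPolynomial.eval u G ≠ 0 →
          (mlSolutions A c u).Finite ∧ (mlSolutions A c u).ncard = N) ∧
        (N < ∑ j, (w j).toNat ↔
          (∏ j ∈ Finset.univ.filter (fun j => w j < 0), (w j : ℂ) ^ (-(w j)).toNat) *
              ∏ j ∈ Finset.univ.filter (fun j => 0 < w j), c j ^ (w j).toNat =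
            (∏ j ∈ Finset.univ.filter (fun j => 0 < w j), (w j : ℂ) ^ (w j).toNat) *
              ∏ j ∈ Finset.univ.filter (fun j => w j < 0), c j ^ (-(w j)).toNat) := by
  intro c hc
  set a := ∏ j, c j ^ (-w j).toNat with ha
  set b := ∏ j, c j ^ (w j).toNat with hb
  have ha0 : a ≠ 0 := Finset.prod_ne_zero_iff.2 fun j _ => pow_ne_zero _ (hc j)
  have hb0 : b ≠ 0 := Finset.prod_ne_zero_iff.2 fun j _ => pow_ne_zero _ (hc j)
  have hdeg : ∀ {u : Fin (d + 1) → ℂ}, ∑ j, u j ≠ 0 → _ := fun hu =>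
    LikelihoodFiber.natDegree_fiberPoly hw0 hwsum (b := b) ha0 hu
  obtain ⟨u₀, hu₀, hsep₀⟩ := LikelihoodFiber.exists_separable_fiberPoly hw0 hwsum ha0 hb0
  have hmap : ∀ u, (LikelihoodFiber.fiberPoly w (MvPolynomial.C a) (MvPolynomial.C b)
      MvPolynomial.X).map (MvPolynomial.eval u) = LikelihoodFiber.fiberPoly w a b u := fun u => by
    simp [LikelihoodFiber.map_fiberPoly]
  obtain ⟨D, hD₀, hD⟩ := Polynomial.exists_eval_ne_zero_imp_separable
    (LikelihoodFiber.fiberPoly w (MvPolynomial.C a) (MvPolynomial.C b) MvPolynomial.X) u₀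
    (hmap u₀ ▸ (hdeg hu₀).1) (hmap u₀ ▸ hsep₀)
  simp only [hmap] at hD
  refine ⟨(LikelihoodFiber.fiberPoly w a b u₀).natDegree,
    D * (∑ j, MvPolynomial.X j) * ∏ x ∈ Finset.univ.offDiag,
      (MvPolynomial.X x.1 * MvPolynomial.C (w x.2 : ℂ) -
        MvPolynomial.X x.2 * MvPolynomial.C (w x.1 : ℂ)), ?_, fun u hu => ?_, ?_⟩
  · refine mul_ne_zero (mul_ne_zero ?_ ?_) (Finset.prod_ne_zero_iff.2 fun x hx => ?_)
    · rintro rfl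
      simp at hD₀
    · intro h
      have := congrArg (MvPolynomial.eval u₀) h
      simp [hu₀] at this
    · intro h
      have := congrArg (MvPolynomial.eval (Pi.single x.1 (1 : ℂ))) h
      have hne : x.2 ≠ x.1 := fun h => (Finset.mem_offDiag.1 hx).2.2 h.symm
      simp [hne, hw0] at this
  · simp only [map_mul, map_sum, map_prod, map_sub, MvPolynomial.eval_X, MvPolynomial.eval_C,
      ne_eq, mul_eq_zero, not_or, Finset.prod_eq_zero_iff, Finset.mem_offDiag, not_exists,
      not_and] at hu
    obtain ⟨⟨huD, husum⟩, hudist⟩ := hu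
    obtain ⟨hF0, hFdeg⟩ := hdeg husum
    rw [← (hdeg hu₀).2] at hFdeg
    have hsep := hD u hF0 hFdeg huD
    rw [LikelihoodFiber.mlSolutions_eq_image hw0 hwA hwsum hker hc husum
      fun i j hij => hudist (i, j) ⟨Finset.mem_univ _, Finset.mem_univ _, hij⟩]
    have hroots : {s | (LikelihoodFiber.fiberPoly w a b u).eval s = 0} =
        (LikelihoodFiber.fiberPoly w a b u).rootSet ℂ := by
      ext s
      simp [Polynomial.mem_rootSet, hF0]
    rw [← ha, ← hb, hroots]
    refine ⟨(Polynomial.rootSet_finite _ _).image _, ?_⟩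
    rw [Set.ncard_image_of_injective, ← hFdeg, ← Nat.card_coe_set_eq, Nat.card_eq_fintype_card]
    · exact Polynomial.card_rootSet_eq_natDegree hsep (IsAlgClosed.splits _)
    · intro s t hst
      have hw : (w 0 : ℂ) ≠ 0 := by exact_mod_cast hw0 0
      have hst' := congrFun hst 0
      rw [div_left_inj' (mul_ne_zero husum (hc 0)), add_right_inj] at hst'
      exact mul_left_cancel₀ hw hst'
  · have hpos : ∀ f : Fin (d + 1) → ℂ,
        ∏ j ∈ Finset.univ.filter (fun j => 0 < w j), f j ^ (w j).toNat =
          ∏ j, f j ^ (w j).toNat := fun f =>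
      Finset.prod_filter_of_ne fun j _ h => by
        by_contra hle
        exact h (by rw [Int.toNat_of_nonpos (not_lt.1 hle), pow_zero])
    have hneg : ∀ f : Fin (d + 1) → ℂ,
        ∏ j ∈ Finset.univ.filter (fun j => w j < 0), f j ^ (-w j).toNat =
          ∏ j, f j ^ (-w j).toNat := fun f =>
      Finset.prod_filter_of_ne fun j _ h => by
        by_contra hle
        exact h (by rw [Int.toNat_of_nonpos (neg_nonpos.2 (not_lt.1 hle)), pow_zero])
    have hδ := LikelihoodFiber.sum_toNat_pos hw0 hwsum
    rw [hpos c, hpos fun j => (w j : ℂ), hneg c, hneg fun j => (w j : ℂ), ← ha, ← hb, (hdeg hu₀).2,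
      mul_comm _ b, mul_comm _ a, eq_comm (a := b * _)]
    split_ifs with h
    · exact iff_of_true (Nat.sub_lt hδ one_pos) h
    · exact iff_of_false (lt_irrefl _) h
end

section
/- For generic u, the set of θ ∈ (ℂ*)^{d−1} with f(θ) ≠ 0 satisfying the likelihood equations u_{i+}·f(θ) = u_+·θ_i·(∂f/∂θ_i)(θ) for i = 1,…,d−2 and M(u)·f(θ) = u_+·θ_{d−1}·(∂f/∂θ_{d−1})(θ) is finite and its cardinality equals the number of distinct complex roots of the product g_1 g_2 ⋯ g_{d−1}. (The ML degree of a scaled rational normal scroll equals the number of distinct roots of g_1 g_2 ⋯ g_{d−1}.) -/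
open scoped BigOperators

/-- The univariate polynomial `g i = ∑_j c i j • x^j` of the `i`-th block of a scaled
rational normal scroll. -/
noncomputable def scrollG {m : ℕ} {n : Fin (m + 1) → ℕ}
    (c : (i : Fin (m + 1)) → Fin (n i + 1) → ℂ) (i : Fin (m + 1)) : Polynomial ℂ :=
  ∑ j, Polynomial.C (c i j) * Polynomial.X ^ (j : ℕ)

/-- `f(θ₁,…,θ_{d-2}, x) = ∑_{i<d-2} θ_i g_i(x) + g_{d-1}(x)` for the scaled rational
normal scroll (here `m = d - 2` and the last variable `θ_{d-1}` is called `x`). -/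
noncomputable def scrollF {m : ℕ} {n : Fin (m + 1) → ℕ}
    (c : (i : Fin (m + 1)) → Fin (n i + 1) → ℂ) (θ : Fin m → ℂ) (x : ℂ) : ℂ :=
  (∑ i : Fin m, θ i * (scrollG c i.castSucc).eval x) + (scrollG c (Fin.last m)).eval x

/-- Solutions of the likelihood equations of the scaled rational normal scroll:
points `(θ, x)` of the torus with `f ≠ 0` satisfying
`u_{i+} f = u_+ θ_i g_i(x)` for `i = 1,…,d-2` and `M(u) f = u_+ x ∂f/∂x`. -/
noncomputable def scrollSols {m : ℕ} {n : Fin (m + 1) → ℕ}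
    (c : (i : Fin (m + 1)) → Fin (n i + 1) → ℂ)
    (u : (i : Fin (m + 1)) → Fin (n i + 1) → ℂ) : Set ((Fin m → ℂ) × ℂ) :=
  {θx | (∀ i, θx.1 i ≠ 0) ∧ θx.2 ≠ 0 ∧ scrollF c θx.1 θx.2 ≠ 0 ∧
    (∀ i : Fin m, (∑ j, u i.castSucc j) * scrollF c θx.1 θx.2 =
      (∑ i', ∑ j, u i' j) * (θx.1 i * (scrollG c i.castSucc).eval θx.2)) ∧
    (∑ i', ∑ j : Fin (n i' + 1), ((j : ℕ) : ℂ) * u i' j) * scrollF c θx.1 θx.2 =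
      (∑ i', ∑ j, u i' j) * (θx.2 *
        ((∑ i : Fin m, θx.1 i * ((scrollG c i.castSucc).derivative.eval θx.2)) +
          (scrollG c (Fin.last m)).derivative.eval θx.2))}

open Polynomial

/-- If one specialization of a polynomial of degree at most `N` with parameters is separable of
degree `N`, then so is a generic one. -/
theorem exists_generic_separable {σ : Type*} (Q : (MvPolynomial σ ℂ)[X]) (N : ℕ) (hN : N ≠ 0)
    (hQ : Q.natDegree ≤ N) (v₀ : σ → ℂ) (hdeg : (Q.map (MvPolynomial.eval v₀)).natDegree = N)
    (hsep : (Q.map (MvPolynomial.eval v₀)).Separable) :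
    ∃ G : MvPolynomial σ ℂ, G ≠ 0 ∧ ∀ v, MvPolynomial.eval v G ≠ 0 →
      (Q.map (MvPolynomial.eval v)).Separable ∧ (Q.map (MvPolynomial.eval v)).natDegree = N := by
  obtain ⟨p, q, -, -, hpq⟩ := exists_mul_add_mul_eq_C_resultant (m := N) (n := N) Q
    (derivative Q) hQ ((natDegree_derivative_le Q).trans (by omega)) (Or.inl hN)
  have hcoeff : MvPolynomial.eval v₀ (Q.coeff N) ≠ 0 := by
    have h0 : Q.map (MvPolynomial.eval v₀) ≠ 0 := by
      rintro h
      simp [h] at hdeg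
      exact hN hdeg.symm
    have := leadingCoeff_ne_zero.mpr h0
    rwa [leadingCoeff, hdeg, coeff_map] at this
  have hres : MvPolynomial.eval v₀ (Q.resultant (derivative Q) N N) ≠ 0 := by
    rw [← resultant_map_map, ← derivative_map]
    set R := Q.map (MvPolynomial.eval v₀)
    have hle : (derivative R).natDegree ≤ N := (natDegree_derivative_le R).trans (by omega)
    obtain ⟨k, hk⟩ := Nat.exists_eq_add_of_le hle
    have h1 : R.resultant (derivative R) N N =
        R.coeff N ^ k * R.resultant (derivative R) N (derivative R).natDegree := by
      conv_lhs => rw [show R.resultant (derivative R) N N =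
        R.resultant (derivative R) N ((derivative R).natDegree + k) by rw [← hk]]
      exact resultant_add_right_deg _ _ _ _ _ le_rfl
    rw [h1]
    refine mul_ne_zero (pow_ne_zero _ (by rwa [coeff_map])) ?_
    have := resultant_ne_zero R (derivative R) hsep
    rwa [hdeg] at this
  refine ⟨Q.resultant (derivative Q) N N * Q.coeff N, fun h ↦ ?_, fun v hv ↦ ?_⟩
  · exact mul_ne_zero hres hcoeff (by rw [← map_mul, h, map_zero])
  rw [map_mul] at hv
  refine ⟨?_, le_antisymm (natDegree_map_le.trans hQ) (le_natDegree_of_ne_zero ?_)⟩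
  · have hu := congrArg (Polynomial.map (MvPolynomial.eval v)) hpq
    rw [Polynomial.map_add, Polynomial.map_mul, Polynomial.map_mul, map_C, ← derivative_map] at hu
    refine ⟨C (MvPolynomial.eval v (Q.resultant (derivative Q) N N))⁻¹ * p.map (MvPolynomial.eval v),
      C (MvPolynomial.eval v (Q.resultant (derivative Q) N N))⁻¹ * q.map (MvPolynomial.eval v), ?_⟩
    rw [mul_assoc, mul_assoc, ← mul_add, mul_comm (p.map _), mul_comm (q.map _), hu, ← C_mul,
      inv_mul_cancel₀ (left_ne_zero_of_mul hv), C_1]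
  · rw [coeff_map]
    exact right_ne_zero_of_mul hv

/-- The numerator of the logarithmic derivative of `p` over the denominator
`∏ r ∈ S, (X - C r)`, where `S` contains the roots of `p`. -/
noncomputable def logDerivNum (S : Finset ℂ) (p : ℂ[X]) : ℂ[X] :=
  ∑ r ∈ S, C (p.rootMultiplicity r : ℂ) * ∏ r' ∈ S.erase r, (X - C r')

theorem natDegree_X_mul_logDerivNum_le (S : Finset ℂ) (p : ℂ[X]) :
    (X * logDerivNum S p).natDegree ≤ S.card := by
  rw [logDerivNum, Finset.mul_sum]
  refine natDegree_sum_le_of_forall_le _ _ fun r hr ↦ ?_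
  have h := Finset.card_erase_add_one hr
  rw [mul_left_comm]
  refine (natDegree_C_mul_le _ _).trans (natDegree_mul_le.trans ?_)
  rw [natDegree_X, natDegree_finsetProd_X_sub_C_eq_card]
  omega

theorem eval_logDerivNum_of_mem {S : Finset ℂ} (p : ℂ[X]) {r : ℂ} (hr : r ∈ S) :
    (logDerivNum S p).eval r = p.rootMultiplicity r * ∏ r' ∈ S.erase r, (r - r') := by
  rw [logDerivNum, eval_finsetSum, Finset.sum_eq_single_of_mem r hr]
  · simp [eval_prod]
  · intro b _ hb
    rw [eval_mul, eval_prod, Finset.prod_eq_zero (Finset.mem_erase.mpr ⟨hb.symm, hr⟩) (by simp),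
      mul_zero]

theorem eval_logDerivNum_of_notMem {S : Finset ℂ} {p : ℂ[X]} (hp : p ≠ 0)
    (hS : p.roots.toFinset ⊆ S) {x : ℂ} (hx : x ∉ S) :
    (logDerivNum S p).eval x =
      (p.derivative.eval x / p.eval x) * (∏ r ∈ S, (X - C r)).eval x := by
  have hpx : p.eval x ≠ 0 := fun h ↦ hx (hS (by simp [hp, h]))
  rw [(IsAlgClosed.splits p).eval_derivative_div_eval_of_ne_zero hpx,
    Finset.sum_multiset_map_count, Finset.sum_subset hS, logDerivNum, eval_finsetSum,
    Finset.sum_mul]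
  · refine Finset.sum_congr rfl fun r hr ↦ ?_
    have hxr : x - r ≠ 0 := sub_ne_zero.mpr fun h ↦ hx (h ▸ hr)
    rw [← Finset.mul_prod_erase S _ hr]
    simp only [eval_mul, eval_C, eval_sub, eval_X, count_roots, nsmul_eq_mul]
    field_simp
  · intro r _ hr
    rw [Multiset.mem_toFinset] at hr
    rw [Multiset.count_eq_zero_of_notMem hr, zero_smul]

/-- Elimination of the linear parameters from the likelihood equations. -/
theorem likelihood_eqs_iff {K : Type*} [Field K] {m : ℕ} (g g' a : Fin (m + 1) → K)
    (θ : Fin m → K) (x M : K) (hs : ∑ i, a i ≠ 0) (ha : ∀ i, a i ≠ 0) :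
    ((∀ i, θ i ≠ 0) ∧ x ≠ 0 ∧ ((∑ i, θ i * g i.castSucc) + g (Fin.last m)) ≠ 0 ∧
      (∀ i : Fin m, a i.castSucc * ((∑ i, θ i * g i.castSucc) + g (Fin.last m)) =
        (∑ i, a i) * (θ i * g i.castSucc)) ∧
      M * ((∑ i, θ i * g i.castSucc) + g (Fin.last m)) =
        (∑ i, a i) * (x * ((∑ i : Fin m, θ i * g' i.castSucc) + g' (Fin.last m)))) ↔
    x ≠ 0 ∧ (∀ i, g i ≠ 0) ∧
      (∀ i : Fin m, θ i = a i.castSucc * g (Fin.last m) / (a (Fin.last m) * g i.castSucc)) ∧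
      x * ∑ i, a i * (g' i / g i) = M := by
  have hsum := Fin.sum_univ_castSucc a
  set s := ∑ i, a i
  set f := (∑ i, θ i * g i.castSucc) + g (Fin.last m) with hf
  clear_value s f
  have key (hg : ∀ i, g i ≠ 0) (hlast : a (Fin.last m) * f = s * g (Fin.last m))
      (hθ : ∀ i : Fin m, a i.castSucc * f = s * (θ i * g i.castSucc)) :
      s * ((∑ i : Fin m, θ i * g' i.castSucc) + g' (Fin.last m)) =
        f * ∑ i, a i * (g' i / g i) := by
    rw [Fin.sum_univ_castSucc, mul_add, mul_add, Finset.mul_sum, Finset.mul_sum]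
    congr 1
    · refine Finset.sum_congr rfl fun i _ ↦ ?_
      have := hg i.castSucc
      field_simp
      linear_combination (-(g' i.castSucc)) * hθ i
    · have := hg (Fin.last m)
      field_simp
      linear_combination (-(g' (Fin.last m))) * hlast
  constructor
  · rintro ⟨-, hx, hf0, hθ, hM⟩
    have hlast : a (Fin.last m) * f = s * g (Fin.last m) := by
      have h1 : s * f = (∑ i : Fin m, a i.castSucc) * f + s * g (Fin.last m) := by
        conv_lhs => rw [hf]
        rw [mul_add, Finset.mul_sum, Finset.sum_mul]
        simp only [hθ]
      linear_combination h1 - f * hsum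
    have hg : ∀ i, g i ≠ 0 := by
      intro i hi
      induction i using Fin.lastCases with
      | last => simp [hi, ha, hf0] at hlast
      | cast i => simpa [hi, ha, hf0] using hθ i
    refine ⟨hx, hg, fun i ↦ ?_, ?_⟩
    · rw [eq_div_iff (mul_ne_zero (ha _) (hg _))]
      refine mul_left_cancel₀ hs ?_
      linear_combination a i.castSucc * hlast - a (Fin.last m) * hθ i
    · refine mul_left_cancel₀ hf0 ?_
      linear_combination -hM - x * key hg hlast hθ
  · rintro ⟨hx, hg, hθ, hM⟩
    have hθg (i : Fin m) : a (Fin.last m) * (θ i * g i.castSucc) =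
        a i.castSucc * g (Fin.last m) := by
      have := hg i.castSucc
      have := ha (Fin.last m)
      rw [hθ i]
      field_simp
    have hlast : a (Fin.last m) * f = s * g (Fin.last m) := by
      rw [hf, mul_add, Finset.mul_sum]
      simp only [hθg]
      rw [← Finset.sum_mul]
      linear_combination (-g (Fin.last m)) * hsum
    have hθ' (i : Fin m) : a i.castSucc * f = s * (θ i * g i.castSucc) := by
      refine mul_left_cancel₀ (ha (Fin.last m)) ?_
      linear_combination a i.castSucc * hlast - s * hθg i
    refine ⟨fun i ↦ ?_, hx, fun h ↦ ?_, hθ', ?_⟩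
    · rw [hθ i]
      exact div_ne_zero (mul_ne_zero (ha _) (hg _)) (mul_ne_zero (ha _) (hg _))
    · rw [h, mul_zero] at hlast
      exact mul_ne_zero hs (hg _) hlast.symm
    · linear_combination (-f) * hM - x * key hg hlast hθ'

section Scroll

variable {m : ℕ} {n : Fin (m + 1) → ℕ} (c : (i : Fin (m + 1)) → Fin (n i + 1) → ℂ)

theorem coeff_scrollG (i : Fin (m + 1)) (j : Fin (n i + 1)) : (scrollG c i).coeff j = c i j := by
  simp [scrollG, coeff_X_pow, Fin.val_inj]

variable (n) in
/-- The linear form `u_{i+}` in the data. -/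
noncomputable def blockSum (i : Fin (m + 1)) :
    MvPolynomial ((i : Fin (m + 1)) × Fin (n i + 1)) ℂ :=
  ∑ j, MvPolynomial.X ⟨i, j⟩

variable (n) in
/-- The linear form `M(u)` in the data. -/
noncomputable def momentSum : MvPolynomial ((i : Fin (m + 1)) × Fin (n i + 1)) ℂ :=
  ∑ i, ∑ j : Fin (n i + 1), MvPolynomial.C ((j : ℕ) : ℂ) * MvPolynomial.X ⟨i, j⟩

/-- The distinct roots of `∏ i, scrollG c i`. -/
noncomputable def scrollRoots : Finset ℂ := (∏ i, scrollG c i).roots.toFinset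

/-- The univariate polynomial whose roots are the `x`-coordinates of the solutions of the
likelihood equations, with coefficients depending on the data. -/
noncomputable def scrollElim : (MvPolynomial ((i : Fin (m + 1)) × Fin (n i + 1)) ℂ)[X] :=
  (∑ i, C (blockSum n i) * (X * logDerivNum (scrollRoots c) (scrollG c i)).map MvPolynomial.C) -
    C (momentSum n) * (∏ r ∈ scrollRoots c, (X - C r)).map MvPolynomial.C

theorem natDegree_scrollElim_le : (scrollElim c).natDegree ≤ (scrollRoots c).card := by
  refine (natDegree_sub_le _ _).trans (max_le ?_ ?_)
  · refine natDegree_sum_le_of_forall_le _ _ fun i _ ↦ ?_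
    exact (natDegree_C_mul_le _ _).trans
      (natDegree_map_le.trans (natDegree_X_mul_logDerivNum_le _ _))
  · refine (natDegree_C_mul_le _ _).trans (natDegree_map_le.trans ?_)
    rw [natDegree_finsetProd_X_sub_C_eq_card]

theorem map_eval_scrollElim (v : ((i : Fin (m + 1)) × Fin (n i + 1)) → ℂ) :
    (scrollElim c).map (MvPolynomial.eval v) =
      (∑ i, C (MvPolynomial.eval v (blockSum n i)) *
        (X * logDerivNum (scrollRoots c) (scrollG c i))) -
      C (MvPolynomial.eval v (momentSum n)) * ∏ r ∈ scrollRoots c, (X - C r) := by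
  have h : (MvPolynomial.eval v).comp MvPolynomial.C = RingHom.id ℂ := by ext; simp
  simp only [scrollElim, Polynomial.map_sub, Polynomial.map_sum, Polynomial.map_mul, map_C,
    Polynomial.map_map, h, Polynomial.map_id]

variable {c}

theorem scrollG_ne_zero (hc : ∀ i j, c i j ≠ 0) (i : Fin (m + 1)) : scrollG c i ≠ 0 := by
  intro h
  have := coeff_scrollG c i 0
  rw [h, coeff_zero] at this
  exact hc i 0 this.symm

theorem mem_scrollRoots (hc : ∀ i j, c i j ≠ 0) {x : ℂ} :
    x ∈ scrollRoots c ↔ ∃ i, (scrollG c i).eval x = 0 := by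
  have h : ∏ i, scrollG c i ≠ 0 := Finset.prod_ne_zero_iff.mpr fun i _ ↦ scrollG_ne_zero hc i
  simp [scrollRoots, h, eval_prod, Finset.prod_eq_zero_iff, -mem_roots', mem_roots]

theorem zero_notMem_scrollRoots (hc : ∀ i j, c i j ≠ 0) : 0 ∉ scrollRoots c := by
  rw [mem_scrollRoots hc]
  rintro ⟨i, hi⟩
  rw [← coeff_zero_eq_eval_zero] at hi
  exact hc i 0 ((coeff_scrollG c i 0).symm.trans hi)

theorem card_scrollRoots_ne_zero (hn : ∀ i, 0 < n i) (hc : ∀ i j, c i j ≠ 0) :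
    (scrollRoots c).card ≠ 0 := by
  have h1 : (scrollG c 0).natDegree ≠ 0 := by
    have : n 0 ≤ (scrollG c 0).natDegree :=
      le_natDegree_of_ne_zero (by simpa using (coeff_scrollG c 0 (Fin.last _)).trans_ne (hc _ _))
    have := hn 0
    omega
  obtain ⟨x, hx⟩ := IsAlgClosed.exists_root (scrollG c 0)
    fun h ↦ h1 (natDegree_eq_of_degree_eq_some h)
  exact Finset.card_ne_zero_of_mem ((mem_scrollRoots hc).mpr ⟨0, hx⟩)

theorem exists_generic_separable_scrollElim (hn : ∀ i, 0 < n i) (hc : ∀ i j, c i j ≠ 0) :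
    ∃ G : MvPolynomial ((i : Fin (m + 1)) × Fin (n i + 1)) ℂ, G ≠ 0 ∧
      ∀ v, MvPolynomial.eval v G ≠ 0 →
        ((scrollElim c).map (MvPolynomial.eval v)).Separable ∧
        ((scrollElim c).map (MvPolynomial.eval v)).natDegree = (scrollRoots c).card := by
  classical
  let v₀ : ((i : Fin (m + 1)) × Fin (n i + 1)) → ℂ := fun p ↦
    if p.1 = 0 then (if (p.2 : ℕ) = 0 then 1 else if (p.2 : ℕ) = 1 then -1 else 0) else 0
  have hsum (k : ℕ) (hk : 0 < k) (w : ℕ → ℂ) : ∑ j : Fin (k + 1),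
      w j * (if (j : ℕ) = 0 then 1 else if (j : ℕ) = 1 then -1 else 0) = w 0 - w 1 := by
    obtain ⟨k, rfl⟩ := Nat.exists_eq_succ_of_ne_zero hk.ne'
    rw [Fin.sum_univ_succ, Fin.sum_univ_succ]
    simp [sub_eq_add_neg]
  have hblock (i : Fin (m + 1)) : MvPolynomial.eval v₀ (blockSum n i) = 0 := by
    by_cases hi : i = 0
    · subst hi
      simpa [blockSum, v₀] using hsum (n 0) (hn 0) 1
    · simp [blockSum, v₀, hi]
  have hmoment : MvPolynomial.eval v₀ (momentSum n) = -1 := by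
    simp only [momentSum, map_sum, map_mul, MvPolynomial.eval_C, MvPolynomial.eval_X]
    rw [Finset.sum_eq_single_of_mem 0 (Finset.mem_univ _)]
    · simpa [v₀] using hsum (n 0) (hn 0) (fun j ↦ (j : ℂ))
    · intro i _ hi
      simp [v₀, hi]
  have hmap : (scrollElim c).map (MvPolynomial.eval v₀) = ∏ r ∈ scrollRoots c, (X - C r) := by
    rw [map_eval_scrollElim]
    simp [hblock, hmoment]
  refine exists_generic_separable _ _ (card_scrollRoots_ne_zero hn hc)
    (natDegree_scrollElim_le c) v₀ ?_ ?_
  · rw [hmap, natDegree_finsetProd_X_sub_C_eq_card]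
  · rw [hmap, separable_prod_X_sub_C_iff']
    exact fun _ _ _ _ h ↦ h

theorem eval_one_blockSum (i : Fin (m + 1)) :
    MvPolynomial.eval (fun _ ↦ 1) (blockSum n i) = ((n i + 1 : ℕ) : ℂ) := by
  simp [blockSum]

/-- For each root `r`, the residue at `r` of the weighted logarithmic derivative is a nonzero
linear form in the data. -/
theorem sum_blockSum_mul_eval_ne_zero (hc : ∀ i j, c i j ≠ 0) {r : ℂ} (hr : r ∈ scrollRoots c) :
    ∑ i, blockSum n i *
      MvPolynomial.C ((logDerivNum (scrollRoots c) (scrollG c i)).eval r) ≠ 0 := by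
  intro h
  have h1 := congrArg (MvPolynomial.eval fun _ ↦ 1) h
  simp only [map_sum, map_mul, eval_one_blockSum, MvPolynomial.eval_C, map_zero,
    eval_logDerivNum_of_mem _ hr, ← mul_assoc] at h1
  rw [← Finset.sum_mul, mul_eq_zero, Finset.prod_eq_zero_iff] at h1
  obtain h1 | ⟨s, hs, h1⟩ := h1
  · obtain ⟨i, hi⟩ := (mem_scrollRoots hc).mp hr
    have hpos := (rootMultiplicity_pos (scrollG_ne_zero hc i)).mpr hi
    have h2 : ∑ i, (n i + 1) * (scrollG c i).rootMultiplicity r = 0 := by exact_mod_cast h1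
    rw [Finset.sum_eq_zero_iff] at h2
    exact (Nat.mul_pos (n i).succ_pos hpos).ne' (h2 i (Finset.mem_univ i))
  · exact (Finset.mem_erase.mp hs).1 (sub_eq_zero.mp h1).symm

theorem blockSum_ne_zero (i : Fin (m + 1)) : blockSum n i ≠ 0 := by
  intro h
  have h1 := congrArg (MvPolynomial.eval fun _ ↦ 1) h
  rw [eval_one_blockSum, map_zero] at h1
  exact Nat.cast_ne_zero.mpr (n i).succ_ne_zero h1

theorem sum_blockSum_ne_zero : ∑ i, blockSum n i ≠ 0 := by
  intro h
  have h1 := congrArg (MvPolynomial.eval fun _ ↦ 1) h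
  rw [map_sum, map_zero] at h1
  simp only [eval_one_blockSum] at h1
  rw [← Nat.cast_sum, Nat.cast_eq_zero, Finset.sum_eq_zero_iff] at h1
  exact (n 0).succ_ne_zero (h1 0 (Finset.mem_univ 0))

theorem momentSum_ne_zero (hn : ∀ i, 0 < n i) : momentSum n ≠ 0 := by
  intro h
  have h1 := congrArg (MvPolynomial.eval fun _ ↦ 1) h
  simp only [momentSum, map_sum, map_mul, MvPolynomial.eval_X, MvPolynomial.eval_C, mul_one,
    map_zero] at h1
  have h2 : ∑ i, ∑ j : Fin (n i + 1), (j : ℕ) = 0 := by exact_mod_cast h1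
  simp only [Finset.sum_eq_zero_iff] at h2
  exact (hn 0).ne' (h2 0 (Finset.mem_univ 0) (Fin.last _) (Finset.mem_univ _))

/-- Under nondegeneracy conditions on the data, the solutions of the likelihood equations are
parametrized by the roots of the eliminant. -/
theorem scrollSols_eq_image (hc : ∀ i j, c i j ≠ 0)
    (u : (i : Fin (m + 1)) → Fin (n i + 1) → ℂ) (a : Fin (m + 1) → ℂ) (M : ℂ)
    (ha : a = fun i ↦ ∑ j, u i j) (hM : M = ∑ i, ∑ j : Fin (n i + 1), ((j : ℕ) : ℂ) * u i j)
    (hs : ∑ i, a i ≠ 0) (ha0 : ∀ i, a i ≠ 0) (hM0 : M ≠ 0)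
    (hres : ∀ r ∈ scrollRoots c,
      ∑ i, a i * (logDerivNum (scrollRoots c) (scrollG c i)).eval r ≠ 0) :
    scrollSols c u = (fun x ↦ ((fun i ↦ a i.castSucc * (scrollG c (Fin.last m)).eval x /
        (a (Fin.last m) * (scrollG c i.castSucc).eval x) : Fin m → ℂ), x)) ''
      {x | ((∑ i, C (a i) * (X * logDerivNum (scrollRoots c) (scrollG c i))) -
        C M * ∏ r ∈ scrollRoots c, (X - C r)).eval x = 0} := by
  have hroot (x : ℂ) : ((∑ i, C (a i) * (X * logDerivNum (scrollRoots c) (scrollG c i))) -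
        C M * ∏ r ∈ scrollRoots c, (X - C r)).eval x = 0 ↔ x ≠ 0 ∧
        (∀ i, (scrollG c i).eval x ≠ 0) ∧ x * ∑ i, a i *
          ((scrollG c i).derivative.eval x / (scrollG c i).eval x) = M := by
    have heval : ((∑ i, C (a i) * (X * logDerivNum (scrollRoots c) (scrollG c i))) -
        C M * ∏ r ∈ scrollRoots c, (X - C r)).eval x =
        x * (∑ i, a i * (logDerivNum (scrollRoots c) (scrollG c i)).eval x) -
        M * (∏ r ∈ scrollRoots c, (X - C r)).eval x := by
      rw [eval_sub, eval_finsetSum, Finset.mul_sum]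
      simp only [eval_mul, eval_C, eval_X, mul_left_comm]
    have hprod : (∏ r ∈ scrollRoots c, (X - C r)).eval x = 0 ↔ x ∈ scrollRoots c := by
      simp [eval_prod, Finset.prod_eq_zero_iff, sub_eq_zero]
    rw [heval]
    by_cases hx : x ∈ scrollRoots c
    · have hx0 : x ≠ 0 := fun h ↦ zero_notMem_scrollRoots hc (h ▸ hx)
      obtain ⟨i, hi⟩ := (mem_scrollRoots hc).mp hx
      rw [hprod.mpr hx, mul_zero, sub_zero]
      exact iff_of_false (mul_ne_zero hx0 (hres x hx)) fun h ↦ h.2.1 i hi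
    · have hg : ∀ i, (scrollG c i).eval x ≠ 0 := fun i hi ↦ hx ((mem_scrollRoots hc).mpr ⟨i, hi⟩)
      have hsub (i : Fin (m + 1)) : (scrollG c i).roots.toFinset ⊆ scrollRoots c := by
        intro r hr
        rw [Multiset.mem_toFinset, mem_roots (scrollG_ne_zero hc i)] at hr
        exact (mem_scrollRoots hc).mpr ⟨i, hr⟩
      simp only [eval_logDerivNum_of_notMem (scrollG_ne_zero hc _) (hsub _) hx, ← mul_assoc]
      rw [← Finset.sum_mul, ← mul_assoc, ← sub_mul, mul_eq_zero, hprod, sub_eq_zero]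
      constructor
      · rintro (h | h)
        · refine ⟨?_, hg, ?_⟩
          · rintro rfl
            exact hM0 (by simpa using h.symm)
          · exact h
        · exact absurd h hx
      · exact fun h ↦ Or.inl h.2.2
  ext ⟨θ, x⟩
  have := likelihood_eqs_iff (fun i ↦ (scrollG c i).eval x)
    (fun i ↦ (scrollG c i).derivative.eval x) a θ x M hs ha0
  subst ha hM
  refine Iff.trans this ?_
  simp only [Set.mem_image, Set.mem_ofPred_eq, hroot, Prod.mk.injEq]
  constructor
  · rintro ⟨h1, h2, h3, h4⟩
    exact ⟨x, ⟨h1, h2, h4⟩, (funext h3).symm, rfl⟩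
  · rintro ⟨y, ⟨h1, h2, h4⟩, h3, rfl⟩
    exact ⟨h1, h2, fun i ↦ (congrFun h3 i).symm, h4⟩

/-- Under nondegeneracy conditions on the data, the number of solutions of the likelihood equations
is the degree of the eliminant. -/
theorem finite_scrollSols_and_ncard (hc : ∀ i j, c i j ≠ 0)
    (u : (i : Fin (m + 1)) → Fin (n i + 1) → ℂ) (a : Fin (m + 1) → ℂ) (M : ℂ)
    (ha : a = fun i ↦ ∑ j, u i j) (hM : M = ∑ i, ∑ j : Fin (n i + 1), ((j : ℕ) : ℂ) * u i j)
    (hs : ∑ i, a i ≠ 0) (ha0 : ∀ i, a i ≠ 0) (hM0 : M ≠ 0)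
    (hres : ∀ r ∈ scrollRoots c,
      ∑ i, a i * (logDerivNum (scrollRoots c) (scrollG c i)).eval r ≠ 0)
    (Q : ℂ[X]) (hQ : Q = (∑ i, C (a i) * (X * logDerivNum (scrollRoots c) (scrollG c i))) -
      C M * ∏ r ∈ scrollRoots c, (X - C r)) (hsep : Q.Separable) :
    (scrollSols c u).Finite ∧ (scrollSols c u).ncard = Q.natDegree := by
  rw [scrollSols_eq_image hc u a M ha hM hs ha0 hM0 hres, ← hQ]
  have hset : {x | Q.eval x = 0} = (Q.roots.toFinset : Set ℂ) := by
    ext x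
    simp [hsep.ne_zero]
  rw [hset]
  refine ⟨(Finset.finite_toSet _).image _, ?_⟩
  rw [Set.ncard_image_of_injective _ fun x y h ↦ congrArg Prod.snd h, Set.ncard_coe_finset,
    Multiset.toFinset_card_of_nodup (nodup_roots hsep),
    ← (IsAlgClosed.splits Q).natDegree_eq_card_roots]

end Scroll

/-- The ML degree of a scaled rational normal scroll equals the number of distinct
complex roots of `g₁ g₂ ⋯ g_{d-1}`. -/
theorem ml_degree_rational_normal_scroll
    (m : ℕ) (n : Fin (m + 1) → ℕ) (hn : ∀ i, 0 < n i)
    (c : (i : Fin (m + 1)) → Fin (n i + 1) → ℂ) (hc : ∀ i j, c i j ≠ 0) :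
    ∃ G : MvPolynomial ((i : Fin (m + 1)) × Fin (n i + 1)) ℂ, G ≠ 0 ∧
      ∀ u : (i : Fin (m + 1)) → Fin (n i + 1) → ℂ,
        MvPolynomial.eval (fun x => u x.1 x.2) G ≠ 0 →
        (scrollSols c u).Finite ∧
        (scrollSols c u).ncard = (∏ i, scrollG c i).roots.toFinset.card := by
  obtain ⟨D, hD0, hD⟩ := exists_generic_separable_scrollElim hn hc
  refine ⟨D * (∑ i, blockSum n i) * (∏ i, blockSum n i) * momentSum n * ∏ r ∈ scrollRoots c,
    ∑ i, blockSum n i * MvPolynomial.C ((logDerivNum (scrollRoots c) (scrollG c i)).eval r),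
    ?_, fun u hu ↦ ?_⟩
  · exact mul_ne_zero (mul_ne_zero (mul_ne_zero (mul_ne_zero hD0 sum_blockSum_ne_zero)
      (Finset.prod_ne_zero_iff.mpr fun i _ ↦ blockSum_ne_zero i)) (momentSum_ne_zero hn))
      (Finset.prod_ne_zero_iff.mpr fun r hr ↦ sum_blockSum_mul_eval_ne_zero hc hr)
  simp only [map_mul, map_prod, map_sum, MvPolynomial.eval_C, mul_ne_zero_iff,
    Finset.prod_ne_zero_iff, Finset.mem_univ, true_imp_iff] at hu
  obtain ⟨⟨⟨⟨hu1, hu2⟩, hu3⟩, hu4⟩, hu5⟩ := hu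
  obtain ⟨hsep, hdeg⟩ := hD _ hu1
  rw [← scrollRoots, ← hdeg]
  have hblock (i : Fin (m + 1)) : MvPolynomial.eval (fun x ↦ u x.1 x.2) (blockSum n i) =
      ∑ j, u i j := by simp [blockSum]
  have hmoment : MvPolynomial.eval (fun x ↦ u x.1 x.2) (momentSum n) =
      ∑ i, ∑ j : Fin (n i + 1), ((j : ℕ) : ℂ) * u i j := by simp [momentSum]
  have hmap := map_eval_scrollElim c fun x ↦ u x.1 x.2
  simp only [hblock, hmoment] at hu2 hu3 hu4 hu5 hmap
  exact finite_scrollSols_and_ncard hc u _ _ rfl rfl hu2 hu3 hu4 hu5 _ hmap hsep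
end

section
/- Let r ≥ 1, let g_1,…,g_r ∈ ℂ[x], let λ_1,…,λ_r ∈ ℂ, and let α ∈ ℂ. If (x−α)² divides the product g_1·g_2·⋯·g_r, then (x−α) divides the polynomial Σ_{i=1}^r λ_i · g_1⋯g_{i−1}·g_i′·g_{i+1}⋯g_r, where g′ denotes the derivative of g. -/
open scoped BigOperators
open Polynomial

theorem X_sub_C_dvd_derivative_mul {R : Type*} [CommRing R] [IsDomain R] {a : R} {p q : R[X]}
    (h : (X - C a) ^ 2 ∣ p * q) : X - C a ∣ derivative p * q := by
  by_cases hq : X - C a ∣ q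
  · exact hq.mul_left _
  · have hp : (X - C a) ^ 2 ∣ p := (prime_X_sub_C a).pow_dvd_of_dvd_mul_right 2 hq h
    obtain ⟨s, rfl⟩ := hp
    refine Dvd.dvd.mul_right ⟨2 * s + (X - C a) * derivative s, ?_⟩ q
    simp only [derivative_mul, derivative_X_sub_C_sq, map_ofNat]
    ring

/-- If `(x - α)²` divides the product `g₁ ⋯ g_r`, then `(x - α)` divides every weighted
product-rule sum `∑ i, λ i • g₁ ⋯ g_{i-1} g_i' g_{i+1} ⋯ g_r`. -/
theorem repeated_root_divides_product_rule_sum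
    (r : ℕ) (hr : 1 ≤ r) (g : Fin r → Polynomial ℂ) (lam : Fin r → ℂ) (α : ℂ)
    (h : (X - C α) ^ 2 ∣ ∏ i, g i) :
    (X - C α) ∣
      ∑ i, C (lam i) * (derivative (g i) * ∏ j ∈ Finset.univ.erase i, g j) := by
  refine Finset.dvd_sum fun i _ => (X_sub_C_dvd_derivative_mul ?_).mul_left _
  rwa [Finset.mul_prod_erase _ _ (Finset.mem_univ i)]
end
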